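/- arXiv:1701.07691 — 4 statements merged into one kernel-verified Lean document; each statement's English description precedes it below -/
import Mathlib

section
/- Let d ≥ 1, E ⊆ ℝ^d be a non-degenerate parallelepiped, f be an E-periodic tempered distribution on ℝ^d, φ a nonzero Schwartz function on ℝ^d, and define V_φf(x,ξ) = (2π)^{-d/2} f(y ↦ conj(φ(y−x)) e^{-i⟨y,ξ⟩}). Assume that for every N ≥ 0 there is a constant C_N > 0 with |V_φf(x,ξ)| ≤ C_N (1+|ξ|)^{-N} for all (x,ξ) ∈ ℝ^d × ℝ^d. Then there exists a smooth E-periodic function g on ℝ^d such that f(ψ) = ∫_{ℝ^d} g(x) ψ(x) dx for every Schwartz function ψ. -/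
open MeasureTheory Filter
open scoped BigOperators InnerProductSpace Topology

noncomputable section

abbrev Euc (d : ℕ) := EuclideanSpace ℝ (Fin d)

/-- The lattice point `∑ i, j i • e i` associated with `j : ℤ^d`. -/
def latPt {d : ℕ} (e : Fin d → Euc d) (j : Fin d → ℤ) : Euc d :=
  ∑ i, (j i : ℝ) • e i

/-- The (closed) parallelepiped spanned by `e`. -/
def paraSet {d : ℕ} (e : Fin d → Euc d) : Set (Euc d) :=
  (fun t : Fin d → ℝ => ∑ i, t i • e i) '' (Set.univ.pi fun _ => Set.Icc (0:ℝ) 1)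

/-- Fourier coefficient `c(f, ξ) = |E|⁻¹ ∫_E f(x) e^{-i⟨x,ξ⟩} dx`. -/
def fourCoeff {d : ℕ} (e : Fin d → Euc d) (f : Euc d → ℂ) (ξ : Euc d) : ℂ :=
  (((volume (paraSet e)).toReal : ℂ))⁻¹ *
    ∫ x in paraSet e, f x * Complex.exp (-(Complex.I) * (⟪x, ξ⟫_ℝ : ℂ))

/-- Iterated partial derivatives along a list of coordinate directions. -/
def pdSeq {d : ℕ} : List (Fin d) → (Euc d → ℂ) → (Euc d → ℂ)
  | [], f => f
  | (i :: L), f => pdSeq L (fun x => fderiv ℝ f x (EuclideanSpace.single i 1))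

/-- The canonical list of directions attached to a multi-index `β`. -/
def mIdxL {d : ℕ} (β : Fin d → ℕ) : List (Fin d) :=
  (List.finRange d).flatMap fun i => List.replicate (β i) i

/-- The multi-index partial derivative `∂^β f`. -/
def pD {d : ℕ} (β : Fin d → ℕ) (f : Euc d → ℂ) : Euc d → ℂ := pdSeq (mIdxL β) f

/-- Fourier transform, normalized as `(2π)^{-d/2} ∫ f(x) e^{-i⟨x,ξ⟩} dx`. -/
def FT {d : ℕ} (f : Euc d → ℂ) (ξ : Euc d) : ℂ :=
  (((2 * Real.pi) ^ (-(d:ℝ)/2) : ℝ) : ℂ) *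
    ∫ x, f x * Complex.exp (-(Complex.I) * (⟪x, ξ⟫_ℝ : ℂ))

/-- Short-time Fourier transform with window `φ`. -/
def STFT {d : ℕ} (φ f : Euc d → ℂ) (x ξ : Euc d) : ℂ :=
  (((2 * Real.pi) ^ (-(d:ℝ)/2) : ℝ) : ℂ) *
    ∫ y, f y * (starRingEnd ℂ) (φ (y - x)) * Complex.exp (-(Complex.I) * (⟪y, ξ⟫_ℝ : ℂ))

/-- A linear functional dominated by the norm of a linear map into a normed space factors through
that map by a continuous functional. -/
lemma exists_strongDual_comp_eq {V B : Type*} [AddCommGroup V] [Module ℂ V]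
    [NormedAddCommGroup B] [NormedSpace ℂ B] (T : V →ₗ[ℂ] B) (f : V →ₗ[ℂ] ℂ) (C : ℝ)
    (h : ∀ v, ‖f v‖ ≤ C * ‖T v‖) : ∃ F : StrongDual ℂ B, ∀ v, F (T v) = f v := by
  obtain ⟨r, hr⟩ := T.rangeRestrict.exists_rightInverse_of_surjective T.range_rangeRestrict
  have hr' : ∀ z, T (r z) = z := fun z => congrArg Subtype.val (LinearMap.congr_fun hr z)
  let f₀ : StrongDual ℂ (LinearMap.range T) := (f ∘ₗ r).mkContinuous C fun z => by
    simpa [hr'] using h (r z)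
  obtain ⟨F, hF, -⟩ := exists_extension_norm_eq _ f₀
  refine ⟨F, fun v => ?_⟩
  have h1 := hF (T.rangeRestrict v)
  have h2 : f (r (T.rangeRestrict v) - v) = 0 := by
    have := h (r (T.rangeRestrict v) - v)
    rw [map_sub T, hr'] at this
    simpa using this
  rw [map_sub, sub_eq_zero] at h2
  exact h1.trans h2

namespace SchwartzMap

variable {d : ℕ}

/-- The weighted derivative `y ↦ ‖y‖ ^ k • D^l ψ(y)` of a Schwartz function, as a bounded
continuous function depending continuously on `ψ`. -/
def weightedDerivCLM (k l : ℕ) :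
    SchwartzMap (Euc d) ℂ →L[ℂ] BoundedContinuousFunction (Euc d) (Euc d [×l]→L[ℝ] ℂ) :=
  mkCLMtoNormedSpace (σ := RingHom.id ℂ)
    (fun ψ => BoundedContinuousFunction.ofNormedAddCommGroup
      (fun y => (‖y‖ ^ k) • iteratedFDeriv ℝ l ψ y)
      ((continuous_norm.pow k).smul
        ((ψ.smooth ⊤).continuous_iteratedFDeriv (mod_cast le_top)))
      (SchwartzMap.seminorm ℂ k l ψ)
      (fun y => by simpa [norm_smul] using le_seminorm ℂ k l ψ y))
    (fun f g => by
      ext1 y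
      have := iteratedFDeriv_add (i := l) (𝕜 := ℝ) (f.smooth l) (g.smooth l)
      simp [show (⇑(f + g) : Euc d → ℂ) = ⇑f + ⇑g from rfl, this])
    (fun a f => by
      ext1 y
      have := iteratedFDeriv_const_smul_apply (𝕜 := ℝ) (a := a) (x := y) (f.smooth l).contDiffAt
      simp [show (⇑(a • f) : Euc d → ℂ) = a • ⇑f from rfl, this, smul_comm (‖y‖ ^ k) a])
    ⟨{(k, l)}, 1, zero_le_one, fun f => by
      rw [one_mul, Finset.sup_singleton]
      exact BoundedContinuousFunction.norm_ofNormedAddCommGroup_le _ (apply_nonneg _ _) _⟩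

lemma weightedDerivCLM_apply (k l : ℕ) (ψ : SchwartzMap (Euc d) ℂ) (y : Euc d) :
    weightedDerivCLM k l ψ y = (‖y‖ ^ k) • iteratedFDeriv ℝ l ψ y := rfl

lemma norm_weightedDerivCLM (k l : ℕ) (ψ : SchwartzMap (Euc d) ℂ) :
    ‖weightedDerivCLM k l ψ‖ = SchwartzMap.seminorm ℂ k l ψ := by
  refine le_antisymm
    ((BoundedContinuousFunction.norm_le (apply_nonneg _ _)).2 fun y => by
      simpa [weightedDerivCLM_apply, norm_smul] using le_seminorm ℂ k l ψ y)
    (seminorm_le_bound ℂ k l ψ (norm_nonneg (weightedDerivCLM k l ψ)) fun y => ?_)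
  simpa [weightedDerivCLM_apply, norm_smul] using (weightedDerivCLM k l ψ).norm_coe_le_norm y

/-- A tempered distribution factors through finitely many weighted derivatives. -/
lemma exists_strongDual_weightedDerivCLM (f : SchwartzMap (Euc d) ℂ →L[ℂ] ℂ) :
    ∃ (s : Finset (ℕ × ℕ)) (F : StrongDual ℂ
      (∀ i : s, BoundedContinuousFunction (Euc d) (Euc d [×i.1.2]→L[ℝ] ℂ))),
      ∀ ψ, f ψ = F (fun i => weightedDerivCLM i.1.1 i.1.2 ψ) := by
  obtain ⟨s, C, -, hC⟩ := Seminorm.bound_of_continuous (schwartz_withSeminorms ℂ (Euc d) ℂ)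
    ((normSeminorm ℂ ℂ).comp f.toLinearMap) (continuous_norm.comp f.continuous)
  let T := ContinuousLinearMap.pi fun i : s => weightedDerivCLM (d := d) i.1.1 i.1.2
  have hT : ∀ ψ, s.sup (schwartzSeminormFamily ℂ (Euc d) ℂ) ψ ≤ ‖T ψ‖ := fun ψ =>
    Seminorm.finset_sup_apply_le (norm_nonneg (T ψ)) fun i hi => by
      rw [schwartzSeminormFamily_apply, ← norm_weightedDerivCLM]
      exact norm_le_pi_norm (T ψ) ⟨i, hi⟩
  have hfT : ∀ ψ, ‖f.toLinearMap ψ‖ ≤ C * ‖T.toLinearMap ψ‖ := fun ψ =>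
    (hC ψ).trans (mul_le_mul_of_nonneg_left (hT ψ) C.2)
  obtain ⟨F, hF⟩ := exists_strongDual_comp_eq
    (B := ∀ i : s, BoundedContinuousFunction (Euc d) (Euc d [×i.1.2]→L[ℝ] ℂ))
    T.toLinearMap f.toLinearMap C hfT
  exact ⟨s, F, fun ψ => (hF ψ).symm⟩

lemma iteratedFDeriv_compSubConstCLM (l : ℕ) (ψ : SchwartzMap (Euc d) ℂ) (a y : Euc d) :
    iteratedFDeriv ℝ l (ψ.compSubConstCLM ℂ a) y = iteratedFDeriv ℝ l ψ (y - a) := by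
  have : (⇑(ψ.compSubConstCLM ℂ a) : Euc d → ℂ) = fun y => ψ (y - a) := rfl
  rw [this, iteratedFDeriv_comp_sub]

lemma pow_add_le_two_pow_mul {x y : ℝ} (hx : 0 ≤ x) (hy : 0 ≤ y) (k : ℕ) :
    (x + y) ^ k ≤ 2 ^ k * (x ^ k + y ^ k) := by
  rcases le_total x y with h | h
  · calc (x + y) ^ k ≤ (2 * y) ^ k := by gcongr; linarith
      _ ≤ _ := by rw [mul_pow]; gcongr; linarith [pow_nonneg hx k]
  · calc (x + y) ^ k ≤ (2 * x) ^ k := by gcongr; linarith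
      _ ≤ _ := by rw [mul_pow]; gcongr; linarith [pow_nonneg hy k]

/-- Moving the weight of a Schwartz seminorm to a point at distance at most `r`. -/
lemma pow_norm_mul_iteratedFDeriv_le (k l : ℕ) (ψ : SchwartzMap (Euc d) ℂ) {y z : Euc d} {r : ℝ}
    (h : ‖y - z‖ ≤ r) : ‖y‖ ^ k * ‖iteratedFDeriv ℝ l ψ z‖ ≤
      2 ^ k * (SchwartzMap.seminorm ℂ k l ψ + r ^ k * SchwartzMap.seminorm ℂ 0 l ψ) := by
  have hr : 0 ≤ r := (norm_nonneg _).trans h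
  have hy : ‖y‖ ≤ ‖z‖ + r := by linarith [norm_le_norm_add_norm_sub' y z]
  calc ‖y‖ ^ k * ‖iteratedFDeriv ℝ l ψ z‖
      ≤ (‖z‖ + r) ^ k * ‖iteratedFDeriv ℝ l ψ z‖ := by gcongr
    _ ≤ (2 ^ k * (‖z‖ ^ k + r ^ k)) * ‖iteratedFDeriv ℝ l ψ z‖ := by
        gcongr; exact pow_add_le_two_pow_mul (norm_nonneg _) hr k
    _ = 2 ^ k * (‖z‖ ^ k * ‖iteratedFDeriv ℝ l ψ z‖ + r ^ k * ‖iteratedFDeriv ℝ l ψ z‖) := by ring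
    _ ≤ _ := by
        gcongr
        · exact le_seminorm ℂ k l ψ z
        · exact norm_iteratedFDeriv_le_seminorm ℂ ψ l z

lemma seminorm_compSubConstCLM_le (k l : ℕ) (ψ : SchwartzMap (Euc d) ℂ) (a : Euc d) :
    SchwartzMap.seminorm ℂ k l (ψ.compSubConstCLM ℂ a) ≤
      2 ^ k * (SchwartzMap.seminorm ℂ k l ψ + ‖a‖ ^ k * SchwartzMap.seminorm ℂ 0 l ψ) := by
  refine seminorm_le_bound ℂ k l _ (by positivity) fun y => ?_
  rw [iteratedFDeriv_compSubConstCLM]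
  exact pow_norm_mul_iteratedFDeriv_le k l ψ (by simp)

lemma seminorm_compSubConstCLM_sub_le (k l : ℕ) (ψ : SchwartzMap (Euc d) ℂ) {a b : Euc d}
    (hab : ‖b - a‖ ≤ 1) :
    SchwartzMap.seminorm ℂ k l (ψ.compSubConstCLM ℂ b - ψ.compSubConstCLM ℂ a) ≤
      2 ^ k * (SchwartzMap.seminorm ℂ k (l + 1) ψ +
        (‖a‖ + 1) ^ k * SchwartzMap.seminorm ℂ 0 (l + 1) ψ) * ‖b - a‖ := by
  refine seminorm_le_bound ℂ k l _ (by positivity) fun y => ?_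
  have hs : iteratedFDeriv ℝ l (ψ.compSubConstCLM ℂ b - ψ.compSubConstCLM ℂ a) y =
      iteratedFDeriv ℝ l ψ (y - b) - iteratedFDeriv ℝ l ψ (y - a) := by
    rw [← iteratedFDeriv_compSubConstCLM, ← iteratedFDeriv_compSubConstCLM]
    exact congrFun (iteratedFDeriv_sub (i := l) (𝕜 := ℝ)
      ((ψ.compSubConstCLM ℂ b).smooth l) ((ψ.compSubConstCLM ℂ a).smooth l)) y
  rw [hs]
  have hmv := (convex_segment (𝕜 := ℝ) (y - a) (y - b)).norm_image_sub_le_of_norm_fderiv_le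
    (f := fun z => (‖y‖ ^ k) • iteratedFDeriv ℝ l ψ z) (𝕜 := ℝ)
    (C := 2 ^ k * (SchwartzMap.seminorm ℂ k (l + 1) ψ +
        (‖a‖ + 1) ^ k * SchwartzMap.seminorm ℂ 0 (l + 1) ψ))
    (fun z _ => (((ψ.smooth ⊤).differentiable_iteratedFDeriv
      (mod_cast ENat.natCast_lt_top l)) z).fun_const_smul _)
    (fun z hz => by
      rw [fderiv_fun_const_smul (((ψ.smooth ⊤).differentiable_iteratedFDeriv
        (mod_cast ENat.natCast_lt_top l)) z), norm_smul, norm_fderiv_iteratedFDeriv]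
      simp only [norm_pow, norm_norm]
      refine pow_norm_mul_iteratedFDeriv_le k (l + 1) ψ ?_
      obtain ⟨t, ht, rfl⟩ := (segment_eq_image' ℝ _ _).subset hz
      have : y - (y - a + t • (y - b - (y - a))) = a + t • (b - a) := by
        simp only [smul_sub]; abel
      rw [this]
      refine (norm_add_le _ _).trans ?_
      rw [norm_smul, Real.norm_of_nonneg ht.1]
      gcongr
      exact mul_le_one₀ ht.2 (norm_nonneg _) hab)
    (left_mem_segment ℝ _ _) (right_mem_segment ℝ _ _)
  have e : y - b - (y - a) = -(b - a) := by abel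
  rw [e, norm_neg] at hmv
  simpa [← smul_sub, norm_smul] using hmv

/-- Translation is continuous in the Schwartz space. -/
lemma continuous_compSubConstCLM (ψ : SchwartzMap (Euc d) ℂ) :
    Continuous fun a : Euc d => ψ.compSubConstCLM ℂ a := by
  rw [continuous_iff_continuousAt]
  intro a
  rw [ContinuousAt, (schwartz_withSeminorms ℂ (Euc d) ℂ).tendsto_nhds]
  rintro ⟨k, l⟩ ε hε
  set K := 2 ^ k * (SchwartzMap.seminorm ℂ k (l + 1) ψ +
        (‖a‖ + 1) ^ k * SchwartzMap.seminorm ℂ 0 (l + 1) ψ)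
  have h1 : Tendsto (fun b => K * ‖b - a‖) (𝓝 a) (𝓝 0) := by
    have : Continuous fun b : Euc d => K * ‖b - a‖ := by fun_prop
    simpa using this.tendsto a
  filter_upwards [h1.eventually_lt_const hε, Metric.closedBall_mem_nhds a zero_lt_one] with b hb hb1
  rw [Metric.mem_closedBall, dist_eq_norm] at hb1
  exact (seminorm_compSubConstCLM_sub_le k l ψ hb1).trans_lt hb

end SchwartzMap

namespace SchwartzMap

variable {d : ℕ}

set_option maxSynthPendingDepth 5 in
/-- Derivatives of a convolution of Schwartz functions fall on one factor. -/
lemma iteratedFDeriv_eq_integral_of_eq_convolution (ρ ψ Ψ : SchwartzMap (Euc d) ℂ)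
    (hΨ : ∀ y, Ψ y = ∫ a, ρ a * ψ (y - a)) (l : ℕ) (y : Euc d) :
    iteratedFDeriv ℝ l Ψ y = ∫ a, ρ a • iteratedFDeriv ℝ l ψ (y - a) := by
  have hcont : ∀ l, Continuous (iteratedFDeriv ℝ l ψ) := fun l =>
    (ψ.smooth ⊤).continuous_iteratedFDeriv (mod_cast le_top)
  have hint : ∀ l y, Integrable fun a => ρ a • iteratedFDeriv ℝ l ψ (y - a) := fun l y => by
    refine (ρ.integrable.norm.mul_const (SchwartzMap.seminorm ℂ 0 l ψ)).mono'
      (ρ.continuous.smul ((hcont l).comp (by fun_prop))).aestronglyMeasurable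
      (Eventually.of_forall fun a => ?_)
    rw [norm_smul]
    gcongr
    exact norm_iteratedFDeriv_le_seminorm ℂ ψ l _
  induction l generalizing y with
  | zero =>
    ext v
    rw [ContinuousMultilinearMap.integral_apply (hint 0 y)]
    simp [hΨ]
  | succ l ih =>
    have hdiff : Differentiable ℝ (iteratedFDeriv ℝ l ψ) :=
      (ψ.smooth ⊤).differentiable_iteratedFDeriv (mod_cast ENat.natCast_lt_top l)
    have hcont' : Continuous (fderiv ℝ (iteratedFDeriv ℝ l ψ)) := by
      have := (continuousMultilinearCurryLeftEquiv ℝ (fun _ : Fin (l + 1) => Euc d) ℂ).continuous.comp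
        (hcont (l + 1))
      rwa [iteratedFDeriv_succ_eq_comp_left, ← Function.comp_assoc,
        LinearIsometryEquiv.self_comp_symm, Function.id_comp] at this
    have hmeas : AEStronglyMeasurable
        (fun a => ρ a • fderiv ℝ (iteratedFDeriv ℝ l ψ) (y - a)) volume := by
      have hc : Continuous fun a => ρ a • fderiv ℝ (iteratedFDeriv ℝ l ψ) (y - a) :=
        ρ.continuous.smul (hcont'.comp (continuous_const.sub continuous_id))
      have := secondCountableTopologyEither_of_left (Euc d) (Euc d →L[ℝ] Euc d [×l]→L[ℝ] ℂ)
      exact hc.aestronglyMeasurable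
    have hder : HasFDerivAt (fun y => ∫ a, ρ a • iteratedFDeriv ℝ l ψ (y - a))
        (∫ a, ρ a • fderiv ℝ (iteratedFDeriv ℝ l ψ) (y - a)) y := by
      refine hasFDerivAt_integral_of_dominated_of_fderiv_le
        (F' := fun z a => ρ a • fderiv ℝ (iteratedFDeriv ℝ l ψ) (z - a))
        (bound := fun a => ‖ρ a‖ * SchwartzMap.seminorm ℂ 0 (l + 1) ψ) univ_mem
        (Eventually.of_forall fun z => (hint l z).aestronglyMeasurable) (hint l y)
        hmeas
        (Eventually.of_forall fun a z _ => ?_) (ρ.integrable.norm.mul_const _)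
        (Eventually.of_forall fun a z _ => ?_)
      · rw [norm_smul, norm_fderiv_iteratedFDeriv]
        gcongr
        exact norm_iteratedFDeriv_le_seminorm ℂ ψ (l + 1) _
      · exact (((hdiff (z - a)).hasFDerivAt.comp z
          ((hasFDerivAt_id z).sub_const a)).const_smul (ρ a))
    have hih : iteratedFDeriv ℝ l Ψ = fun y => ∫ a, ρ a • iteratedFDeriv ℝ l ψ (y - a) :=
      funext ih
    rw [iteratedFDeriv_succ_eq_comp_left, Function.comp_apply, hih, hder.fderiv]
    refine ((continuousMultilinearCurryLeftEquiv ℝ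
      (fun _ : Fin (l + 1) => Euc d) ℂ).symm.toLinearIsometry.toContinuousLinearMap.integral_comp_comm
      ?_).symm.trans ?_
    · refine (ρ.integrable.norm.mul_const (SchwartzMap.seminorm ℂ 0 (l + 1) ψ)).mono'
        hmeas
        (Eventually.of_forall fun a => ?_)
      rw [norm_smul, norm_fderiv_iteratedFDeriv]
      gcongr
      exact norm_iteratedFDeriv_le_seminorm ℂ ψ (l + 1) _
    · refine integral_congr_ae (Eventually.of_forall fun a => ?_)
      ext v
      simp [iteratedFDeriv_succ_eq_comp_left]

set_option maxSynthPendingDepth 5 in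
/-- A tempered distribution commutes with convolution integrals of Schwartz functions. -/
lemma apply_eq_integral_of_eq_convolution (f : SchwartzMap (Euc d) ℂ →L[ℂ] ℂ)
    (ρ ψ Ψ : SchwartzMap (Euc d) ℂ) (hΨ : ∀ y, Ψ y = ∫ a, ρ a * ψ (y - a)) :
    f Ψ = ∫ a, ρ a * f (ψ.compSubConstCLM ℂ a) := by
  obtain ⟨s, F, hF⟩ := exists_strongDual_weightedDerivCLM f
  have hint : ∀ i : s, Integrable fun a =>
      ρ a • weightedDerivCLM i.1.1 i.1.2 (ψ.compSubConstCLM ℂ a) := fun i => by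
    set k := i.1.1
    set l := i.1.2
    refine (((ρ.integrable_pow_mul volume 0).const_mul (2 ^ k * SchwartzMap.seminorm ℂ k l ψ)).add
      ((ρ.integrable_pow_mul volume k).const_mul (2 ^ k * SchwartzMap.seminorm ℂ 0 l ψ))).mono'
      (ρ.continuous.smul ((weightedDerivCLM k l).continuous.comp
        (continuous_compSubConstCLM ψ))).aestronglyMeasurable
      (Eventually.of_forall fun a => ?_)
    rw [norm_smul, norm_weightedDerivCLM]
    refine (mul_le_mul_of_nonneg_left (seminorm_compSubConstCLM_le k l ψ a)
      (norm_nonneg _)).trans_eq ?_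
    simp only [Pi.add_apply, pow_zero]
    ring
  have hint' : Integrable fun a => fun i : s =>
      ρ a • weightedDerivCLM i.1.1 i.1.2 (ψ.compSubConstCLM ℂ a) :=
    Integrable.of_eval hint
  have hval : (fun i : s => weightedDerivCLM i.1.1 i.1.2 Ψ) = ∫ a, fun i : s =>
      ρ a • weightedDerivCLM i.1.1 i.1.2 (ψ.compSubConstCLM ℂ a) := by
    funext i
    rw [eval_integral hint]
    ext1 y
    rw [weightedDerivCLM_apply, iteratedFDeriv_eq_integral_of_eq_convolution ρ ψ Ψ hΨ,
      ← integral_smul]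
    refine Eq.trans ?_
      ((BoundedContinuousFunction.evalCLM ℝ y).integral_comp_comm (hint i))
    refine integral_congr_ae (Eventually.of_forall fun a => ?_)
    change ‖y‖ ^ i.1.1 • ρ a • iteratedFDeriv ℝ i.1.2 ψ (y - a) =
      ρ a • (‖y‖ ^ i.1.1 • iteratedFDeriv ℝ i.1.2 (ψ.compSubConstCLM ℂ a) y)
    rw [iteratedFDeriv_compSubConstCLM, smul_comm]
  rw [hF, hval, ← F.integral_comp_comm hint']
  refine integral_congr_ae (Eventually.of_forall fun a => ?_)
  simp only [hF (ψ.compSubConstCLM ℂ a)]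
  rw [← smul_eq_mul, ← map_smul]
  rfl

end SchwartzMap

/-- The plane wave `x ↦ e^{2πi⟨x,w⟩}`. -/
def planeWave {d : ℕ} (w x : Euc d) : ℂ := Complex.exp (2 * Real.pi * Complex.I * (⟪x, w⟫_ℝ : ℂ))

/-- The coordinates `⟨x, v i⟩` of `x`, taken modulo `1`. -/
def torusCoord {d : ℕ} (v : Fin d → Euc d) (x : Euc d) : UnitAddTorus (Fin d) :=
  fun i => ((⟪x, v i⟫_ℝ : ℝ) : UnitAddCircle)

section Lattice

variable {d : ℕ}

lemma norm_planeWave (w x : Euc d) : ‖planeWave w x‖ = 1 := by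
  rw [planeWave, show (2 * Real.pi * Complex.I * (⟪x, w⟫_ℝ : ℂ)) =
    ((2 * Real.pi * ⟪x, w⟫_ℝ : ℝ) : ℂ) * Complex.I by push_cast; ring]
  exact Complex.norm_exp_ofReal_mul_I _

lemma planeWave_add (w x y : Euc d) : planeWave w (x + y) = planeWave w x * planeWave w y := by
  rw [planeWave, planeWave, planeWave, ← Complex.exp_add, inner_add_left]
  push_cast
  ring_nf

lemma continuous_planeWave (w : Euc d) : Continuous (planeWave w) := by
  unfold planeWave
  fun_prop

lemma exists_dual_basis {e : Fin d → Euc d} (he : LinearIndependent ℝ e) :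
    ∃ v : Fin d → Euc d, (∀ i j, ⟪e i, v j⟫_ℝ = if i = j then 1 else 0) ∧
      ∀ x, ∑ i, ⟪x, v i⟫_ℝ • e i = x := by
  classical
  let b := basisOfLinearIndependentOfCardEqFinrank' e he (by simp)
  have hb : ∀ i, b i = e i := fun i => by simp [b]
  let v : Fin d → Euc d := fun i =>
    (InnerProductSpace.toDual ℝ (Euc d)).symm (LinearMap.toContinuousLinearMap (b.coord i))
  have hv : ∀ x i, ⟪x, v i⟫_ℝ = b.repr x i := fun x i => by
    rw [real_inner_comm, InnerProductSpace.toDual_symm_apply]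
    simp
  refine ⟨v, fun i j => ?_, fun x => ?_⟩
  · rw [hv, ← hb, b.repr_self, Finsupp.single_apply]
  · simp_rw [hv, ← hb]
    exact b.sum_repr x

lemma inner_latPt_eq {e v : Fin d → Euc d}
    (hev : ∀ i j, ⟪e i, v j⟫_ℝ = if i = j then 1 else 0) (k : Fin d → ℤ) (j : Fin d) :
    ⟪latPt e k, v j⟫_ℝ = k j := by
  simp [latPt, sum_inner, inner_smul_left, hev]

lemma continuous_torusCoord (v : Fin d → Euc d) : Continuous (torusCoord v) :=
  continuous_pi fun i => (AddCircle.continuous_mk' 1).comp (by fun_prop)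

lemma torusCoord_add (v : Fin d → Euc d) (x y : Euc d) :
    torusCoord v (x + y) = torusCoord v x + torusCoord v y := by
  funext i
  simp [torusCoord, inner_add_left]

lemma mFourier_torusCoord (v : Fin d → Euc d) (m : Fin d → ℤ) (x : Euc d) :
    UnitAddTorus.mFourier m (torusCoord v x) = planeWave (latPt v m) x := by
  simp only [UnitAddTorus.mFourier, ContinuousMap.coe_mk, torusCoord, fourier_coe_apply,
    planeWave, ← Complex.exp_sum, latPt, inner_sum, inner_smul_right]
  congr 1
  push_cast
  rw [Finset.mul_sum]
  exact Finset.sum_congr rfl fun i _ => by ring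

/-- The plane waves with frequencies in the dual lattice are periodic. -/
lemma planeWave_add_latPt {e v : Fin d → Euc d}
    (hev : ∀ i j, ⟪e i, v j⟫_ℝ = if i = j then 1 else 0) (m k : Fin d → ℤ) (x : Euc d) :
    planeWave (latPt v m) (x + latPt e k) = planeWave (latPt v m) x := by
  rw [← mFourier_torusCoord, ← mFourier_torusCoord, torusCoord_add]
  have : torusCoord v (latPt e k) = 0 := by
    funext i
    rw [torusCoord, inner_latPt_eq hev]
    exact (AddCircle.coe_eq_zero_iff 1).2 ⟨k i, by simp⟩
  rw [this, add_zero]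

lemma torusCoord_surjective {e v : Fin d → Euc d}
    (hev : ∀ i j, ⟪e i, v j⟫_ℝ = if i = j then 1 else 0) :
    Function.Surjective (torusCoord v) := by
  intro t
  choose r hr using fun i => QuotientAddGroup.mk_surjective (t i)
  refine ⟨∑ i, r i • e i, funext fun j => ?_⟩
  rw [← hr j, torusCoord, sum_inner]
  simp [inner_smul_left, hev]

/-- A continuous periodic function descends to the torus. -/
lemma exists_continuousMap_torusCoord {e v : Fin d → Euc d}
    (hsum : ∀ x, ∑ i, ⟪x, v i⟫_ℝ • e i = x) {h : Euc d → ℂ} (hc : Continuous h)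
    (hper : ∀ x k, h (x + latPt e k) = h x) :
    ∃ H : C(UnitAddTorus (Fin d), ℂ), ∀ x, H (torusCoord v x) = h x := by
  let q : C(Fin d → ℝ, UnitAddTorus (Fin d)) :=
    ⟨Pi.map fun _ => ((↑) : ℝ → UnitAddCircle), by fun_prop⟩
  have hq : IsOpenQuotientMap q :=
    IsOpenQuotientMap.piMap fun _ => QuotientAddGroup.isOpenQuotientMap_mk
  let p : C(Fin d → ℝ, ℂ) := ⟨fun t => h (∑ i, t i • e i), by fun_prop⟩
  have hfac : Function.FactorsThrough p q := by
    intro s t hst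
    have h1 : ∀ i, ∃ n : ℤ, n • (1 : ℝ) = s i - t i := fun i => by
      rw [← AddCircle.coe_eq_zero_iff, AddCircle.coe_sub, sub_eq_zero]
      exact congrFun hst i
    choose k hk using h1
    have : ∑ i, s i • e i = ∑ i, t i • e i + latPt e k := by
      rw [latPt, ← Finset.sum_add_distrib]
      refine Finset.sum_congr rfl fun i _ => ?_
      rw [← add_smul]
      congr 1
      have := hk i
      simp at this
      linarith
    change h _ = h _
    rw [this, hper]
  refine ⟨hq.isQuotientMap.lift p hfac, fun x => ?_⟩
  refine (DFunLike.congr_fun (hq.isQuotientMap.lift_comp p hfac) fun i => ⟪x, v i⟫_ℝ).trans ?_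
  change h _ = h x
  rw [hsum]

/-- The dual lattice is large enough for inverse powers to be summable. -/
lemma summable_one_add_norm_latPt {v : Fin d → Euc d} (hv : LinearIndependent ℝ v) :
    Summable fun m : Fin d → ℤ => (1 + ‖latPt v m‖) ^ (-(d + 1 : ℝ)) := by
  let b := basisOfLinearIndependentOfCardEqFinrank' v hv (by simp)
  let L := Submodule.span ℤ (Set.range b)
  have hb : ∀ i, b i = v i := fun i => by simp [b]
  have hmem : ∀ m, latPt v m ∈ L := fun m => by
    rw [latPt]
    refine Submodule.sum_mem _ fun i _ => ?_
    rw [← hb, Int.cast_smul_eq_zsmul]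
    exact Submodule.smul_mem _ _ (Submodule.subset_span ⟨i, rfl⟩)
  have hinj : Function.Injective fun m : Fin d → ℤ => (⟨latPt v m, hmem m⟩ : L) := by
    intro m n hmn
    have h1 : latPt v m = latPt v n := congrArg Subtype.val hmn
    have h2 := Fintype.linearIndependent_iff.1 hv (fun i => (m i : ℝ) - n i) (by
      simpa [latPt, sub_smul, sub_eq_zero] using h1)
    funext i
    exact_mod_cast sub_eq_zero.1 (h2 i)
  have hs := ZLattice.summable_norm_rpow L (-(d + 1 : ℝ)) (by
    rw [ZLattice.rank ℝ L]
    simp)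
  have hs' := hs.comp_injective hinj
  refine Summable.of_norm_bounded_eventually hs' ?_
  filter_upwards [(Set.finite_singleton (0 : Fin d → ℤ)).compl_mem_cofinite] with m hm
  have hpos : 0 < ‖latPt v m‖ := by
    rw [norm_pos_iff]
    intro h0
    refine hm (hinj (Subtype.ext ?_))
    simpa [latPt] using h0
  rw [Real.norm_of_nonneg (by positivity)]
  exact Real.rpow_le_rpow_of_nonpos hpos (le_add_of_nonneg_left zero_le_one) (by linarith [Nat.cast_nonneg (α := ℝ) d])

end Lattice

section Torus

/-- The circle carries its normalized Haar measure, as in the theory of multiple Fourier series. -/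
local instance : MeasureSpace UnitAddCircle := ⟨AddCircle.haarAddCircle⟩

local instance : Measure.IsAddHaarMeasure (volume : Measure UnitAddCircle) :=
  inferInstanceAs (Measure.IsAddHaarMeasure AddCircle.haarAddCircle)

local instance : IsProbabilityMeasure (volume : Measure UnitAddCircle) :=
  inferInstanceAs (IsProbabilityMeasure AddCircle.haarAddCircle)

lemma mFourier_neg_eq_mul {ι : Type*} [Fintype ι] (m : ι → ℤ) (t s : UnitAddTorus ι) :
    UnitAddTorus.mFourier (-m) t =
      UnitAddTorus.mFourier m s * UnitAddTorus.mFourier (-m) (t + s) := by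
  simp only [UnitAddTorus.mFourier, ContinuousMap.coe_mk, ← Finset.prod_mul_distrib, Pi.neg_apply,
    Pi.add_apply]
  refine Finset.prod_congr rfl fun i _ => ?_
  generalize t i = x
  generalize s i = y
  induction x using QuotientAddGroup.induction_on with | H x => ?_
  induction y using QuotientAddGroup.induction_on with | H y => ?_
  rw [← QuotientAddGroup.mk_add, fourier_coe_apply, fourier_coe_apply, fourier_coe_apply,
    ← Complex.exp_add]
  congr 1
  push_cast
  ring

/-- Convolution along a translation flow of the torus multiplies the Fourier coefficients. -/
lemma mFourierCoeff_of_eq_integral {d : ℕ} (v : Fin d → Euc d) {ρ : Euc d → ℂ}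
    (hρc : Continuous ρ) (hρ : Integrable ρ) (H H' : C(UnitAddTorus (Fin d), ℂ))
    (hH : ∀ t, H' t = ∫ a, ρ a * H (t + torusCoord v a)) (m : Fin d → ℤ) :
    UnitAddTorus.mFourierCoeff H' m =
      (∫ a, ρ a * planeWave (latPt v m) a) * UnitAddTorus.mFourierCoeff H m := by
  have hs := continuous_torusCoord v
  have hint : Integrable (fun p : UnitAddTorus (Fin d) × Euc d =>
      UnitAddTorus.mFourier (-m) p.1 * (ρ p.2 * H (p.1 + torusCoord v p.2)))
      (volume.prod volume) := by
    refine ((hρ.comp_snd volume).norm.mul_const ‖H‖).mono' (Continuous.aestronglyMeasurable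
      (by fun_prop)) (Eventually.of_forall fun p => ?_)
    rw [norm_mul, norm_mul]
    have h1 := (UnitAddTorus.mFourier (-m)).norm_coe_le_norm p.1
    rw [UnitAddTorus.mFourier_norm] at h1
    have h2 := H.norm_coe_le_norm (p.1 + torusCoord v p.2)
    calc _ ≤ 1 * (‖ρ p.2‖ * ‖H‖) := by gcongr
      _ = _ := one_mul _
  calc UnitAddTorus.mFourierCoeff H' m
      = ∫ t, ∫ a, UnitAddTorus.mFourier (-m) t * (ρ a * H (t + torusCoord v a)) := by
        simp only [UnitAddTorus.mFourierCoeff, hH, smul_eq_mul, integral_const_mul]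
    _ = ∫ a, ∫ t, UnitAddTorus.mFourier (-m) t * (ρ a * H (t + torusCoord v a)) :=
        integral_integral_swap hint
    _ = ∫ a, (ρ a * planeWave (latPt v m) a) * UnitAddTorus.mFourierCoeff H m := by
        congr 1
        funext a
        rw [UnitAddTorus.mFourierCoeff, ← integral_add_right_eq_self
          (fun t => UnitAddTorus.mFourier (-m) t • H t) (torusCoord v a), ← integral_const_mul]
        congr 1
        funext t
        rw [mFourier_neg_eq_mul m t (torusCoord v a), mFourier_torusCoord, smul_eq_mul]
        ring
    _ = _ := integral_mul_const _ _

lemma norm_mFourierCoeff_le {d : ℕ} (H : C(UnitAddTorus (Fin d), ℂ)) {C : ℝ}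
    (hC : ∀ t, ‖H t‖ ≤ C) (m : Fin d → ℤ) : ‖UnitAddTorus.mFourierCoeff H m‖ ≤ C := by
  refine (norm_integral_le_of_norm_le_const (C := C) (Eventually.of_forall fun t => ?_)).trans
    (by simp)
  have h1 := (UnitAddTorus.mFourier (-m)).norm_coe_le_norm t
  rw [UnitAddTorus.mFourier_norm] at h1
  rw [norm_smul]
  exact (mul_le_of_le_one_left (norm_nonneg _) h1).trans (hC t)

end Torus

section PlaneWave

variable {d : ℕ}

lemma contDiff_planeWave (w : Euc d) (n : WithTop ℕ∞) : ContDiff ℝ n (planeWave w) := by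
  unfold planeWave
  exact (contDiff_const.mul (Complex.ofRealCLM.contDiff.comp
    (contDiff_id.inner ℝ contDiff_const))).cexp

lemma iteratedDeriv_cexp_mul_ofReal (z : ℂ) (n : ℕ) :
    iteratedDeriv n (fun s : ℝ => Complex.exp (z * s)) =
      fun s : ℝ => z ^ n * Complex.exp (z * s) := by
  induction n with
  | zero => simp
  | succ n ih =>
    rw [iteratedDeriv_succ, ih]
    funext s
    have h : HasDerivAt (fun s : ℝ => Complex.exp (z * s)) (Complex.exp (z * s) * (z * 1)) s :=
      ((Complex.ofRealCLM.hasDerivAt.const_mul z).cexp)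
    rw [(h.const_mul (z ^ n)).deriv]
    ring

lemma norm_iteratedFDeriv_planeWave_le (w : Euc d) (n : ℕ) (x : Euc d) :
    ‖iteratedFDeriv ℝ n (planeWave w) x‖ ≤ (2 * Real.pi * ‖w‖) ^ n := by
  have hcomp : planeWave w =
      (fun s : ℝ => Complex.exp (2 * Real.pi * Complex.I * s)) ∘ (innerSL ℝ w) := by
    funext y
    simp [planeWave, real_inner_comm]
  have hsmooth : ContDiff ℝ n fun s : ℝ => Complex.exp (2 * Real.pi * Complex.I * s) :=
    (contDiff_const.mul Complex.ofRealCLM.contDiff).cexp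
  rw [hcomp, (innerSL ℝ w).iteratedFDeriv_comp_right hsmooth x le_rfl]
  refine (ContinuousMultilinearMap.norm_compContinuousLinearMap_le _ _).trans ?_
  rw [norm_iteratedFDeriv_eq_norm_iteratedDeriv, iteratedDeriv_cexp_mul_ofReal, norm_mul,
    show (2 * Real.pi * Complex.I * ((innerSL ℝ w x : ℝ) : ℂ)) =
    ((2 * Real.pi * innerSL ℝ w x : ℝ) : ℂ) * Complex.I by push_cast; ring,
    Complex.norm_exp_ofReal_mul_I]
  simp [mul_pow, abs_of_pos Real.pi_pos]

lemma SchwartzMap.integrable_mul_planeWave (ψ : SchwartzMap (Euc d) ℂ) (w : Euc d) :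
    Integrable fun a => ψ a * planeWave w a :=
  ψ.integrable.mul_bdd (c := 1) (continuous_planeWave w).aestronglyMeasurable
    (Eventually.of_forall fun a => (norm_planeWave w a).le)

/-- A nonzero Schwartz function has a nonzero Fourier integral. -/
lemma SchwartzMap.exists_integral_mul_planeWave_ne_zero {ψ : SchwartzMap (Euc d) ℂ} (hψ : ψ ≠ 0) :
    ∃ w, ∫ a, ψ a * planeWave w a ≠ 0 := by
  by_contra! h
  refine hψ ?_
  have h0 : (FourierTransformInv.fourierInv ψ : SchwartzMap (Euc d) ℂ) = 0 := by
    ext w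
    rw [SchwartzMap.fourierInv_coe, Real.fourierInv_eq']
    refine Eq.trans ?_ (h w)
    congr 1
    funext a
    rw [planeWave, smul_eq_mul, mul_comm]
    congr 2
    push_cast
    ring
  rw [← FourierTransform.fourier_fourierInv_eq (F := SchwartzMap (Euc d) ℂ) ψ, h0]
  exact (FourierTransform.fourierCLM ℂ (SchwartzMap (Euc d) ℂ)).map_zero

/-- A series of plane waves with rapidly decreasing coefficients is smooth. -/
lemma contDiff_tsum_planeWave {ι : Type*} (c : ι → ℂ) (w : ι → Euc d)
    (h : ∀ n : ℕ, Summable fun m => ‖c m‖ * ‖w m‖ ^ n) :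
    ContDiff ℝ (⊤ : ℕ∞) fun x => ∑' m, c m * planeWave (w m) x := by
  refine contDiff_tsum (v := fun n m => ‖c m‖ * (2 * Real.pi * ‖w m‖) ^ n)
    (fun m => contDiff_const.mul (contDiff_planeWave _ _)) (fun n _ => ?_) (fun n m x _ => ?_)
  · refine ((h n).mul_left ((2 * Real.pi) ^ n)).congr fun m => ?_
    rw [mul_pow]
    ring
  · have : iteratedFDeriv ℝ n (fun x => c m * planeWave (w m) x) x =
        c m • iteratedFDeriv ℝ n (planeWave (w m)) x :=
      iteratedFDeriv_const_smul_apply (a := c m) (contDiff_planeWave (w m) n).contDiffAt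
    rw [this, norm_smul]
    gcongr
    exact norm_iteratedFDeriv_planeWave_le _ _ _

/-- Termwise integration of a series of plane waves against a Schwartz function. -/
lemma SchwartzMap.hasSum_integral_tsum_planeWave {ι : Type*} [Countable ι] (c : ι → ℂ)
    (w : ι → Euc d) (h : Summable fun m => ‖c m‖) (ψ : SchwartzMap (Euc d) ℂ) :
    HasSum (fun m => c m * ∫ a, ψ a * planeWave (w m) a)
      (∫ x, (∑' m, c m * planeWave (w m) x) * ψ x) := by
  have hnorm : ∀ m x, ‖c m * (ψ x * planeWave (w m) x)‖ = ‖c m‖ * ‖ψ x‖ := fun m x => by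
    rw [norm_mul, norm_mul, norm_planeWave, mul_one]
  have hs := hasSum_integral_of_summable_integral_norm (μ := volume)
    (F := fun m x => c m * (ψ x * planeWave (w m) x))
    (fun m => (ψ.integrable_mul_planeWave (w m)).const_mul (c m)) (by
      simp only [hnorm, integral_const_mul]
      exact h.mul_right _)
  simp only [integral_const_mul] at hs
  have heq : ∀ x, (∑' m, c m * planeWave (w m) x) * ψ x =
      ∑' m, c m * (ψ x * planeWave (w m) x) := fun x => by
    rw [← tsum_mul_right]
    exact tsum_congr fun m => by ring
  simpa only [heq] using hs

end PlaneWave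

section Periodic

variable {d : ℕ}

/-- Two Schwartz functions have a Schwartz convolution, which is symmetric in the factors. -/
lemma SchwartzMap.exists_eq_convolution (ρ ψ : SchwartzMap (Euc d) ℂ) :
    ∃ Ψ : SchwartzMap (Euc d) ℂ, (∀ y, Ψ y = ∫ a, ρ a * ψ (y - a)) ∧
      ∀ y, Ψ y = ∫ a, ψ a * ρ (y - a) := by
  have h : ∀ y, SchwartzMap.convolution (ContinuousLinearMap.mul ℂ ℂ) ρ ψ y =
      ∫ a, ρ a * ψ (y - a) := fun y => SchwartzMap.convolution_apply _ _ _ _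
  refine ⟨_, h, fun y => ?_⟩
  rw [h, ← integral_sub_left_eq_self _ volume y]
  simp [mul_comm]

/-- The Fourier coefficients of the orbit functions `x ↦ f (τ_x ψ)` of a tempered distribution
are proportional to the Fourier integrals of `ψ`. -/
lemma mFourierCoeff_mul_integral_comm {v : Fin d → Euc d}
    (hsurj : Function.Surjective (torusCoord v)) (f : SchwartzMap (Euc d) ℂ →L[ℂ] ℂ)
    (lift : ∀ ψ : SchwartzMap (Euc d) ℂ, ∃ H : C(UnitAddTorus (Fin d), ℂ),
      ∀ x, H (torusCoord v x) = f (ψ.compSubConstCLM ℂ x))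
    (ρ ψ : SchwartzMap (Euc d) ℂ) {Hρ Hψ : C(UnitAddTorus (Fin d), ℂ)}
    (hρ : ∀ x, Hρ (torusCoord v x) = f (ρ.compSubConstCLM ℂ x))
    (hψ : ∀ x, Hψ (torusCoord v x) = f (ψ.compSubConstCLM ℂ x)) (m : Fin d → ℤ) :
    (∫ a, ρ a * planeWave (latPt v m) a) * UnitAddTorus.mFourierCoeff Hψ m =
      (∫ a, ψ a * planeWave (latPt v m) a) * UnitAddTorus.mFourierCoeff Hρ m := by
  obtain ⟨Ψ, h1, h2⟩ := ρ.exists_eq_convolution ψ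
  obtain ⟨H, hH⟩ := lift Ψ
  have key : ∀ (ρ ψ : SchwartzMap (Euc d) ℂ) (Hψ : C(UnitAddTorus (Fin d), ℂ)),
      (∀ x, Hψ (torusCoord v x) = f (ψ.compSubConstCLM ℂ x)) →
      (∀ y, Ψ y = ∫ a, ρ a * ψ (y - a)) →
      ∀ t, H t = ∫ a, ρ a * Hψ (t + torusCoord v a) := by
    intro ρ ψ Hψ hψ hΨ t
    obtain ⟨x, rfl⟩ := hsurj t
    rw [hH, SchwartzMap.apply_eq_integral_of_eq_convolution f ρ (ψ.compSubConstCLM ℂ x)]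
    · congr 1
      funext a
      rw [← torusCoord_add, hψ]
      congr 2
      ext y
      change ψ (y - a - x) = ψ (y - (x + a))
      congr 1
      abel
    · intro y
      change Ψ (y - x) = ∫ a, ρ a * ψ (y - a - x)
      rw [hΨ]
      congr 1
      funext a
      congr 2
      abel
  rw [← mFourierCoeff_of_eq_integral v ρ.continuous ρ.integrable Hψ H (key ρ ψ Hψ hψ h1) m,
    ← mFourierCoeff_of_eq_integral v ψ.continuous ψ.integrable Hρ H (key ψ ρ Hρ hρ h2) m]

end Periodic

section Decay

variable {d : ℕ}

/-- The vectors dual to a family are linearly independent. -/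
lemma linearIndependent_of_inner_eq {e v : Fin d → Euc d}
    (hev : ∀ i j, ⟪e i, v j⟫_ℝ = if i = j then 1 else 0) : LinearIndependent ℝ v := by
  rw [Fintype.linearIndependent_iff]
  intro c hc i
  have := congrArg (fun x => ⟪e i, x⟫_ℝ) hc
  simpa [inner_sum, inner_smul_right, hev] using this

lemma one_add_norm_sub_rpow_neg_le (w w₀ : Euc d) {N : ℝ} (hN : 0 ≤ N) :
    (1 + ‖(2 * Real.pi) • (w - w₀)‖) ^ (-N) ≤ (1 + ‖w₀‖) ^ N * (1 + ‖w‖) ^ (-N) := by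
  have h1 : ‖w - w₀‖ ≤ ‖(2 * Real.pi) • (w - w₀)‖ := by
    rw [norm_smul, Real.norm_of_nonneg (by positivity)]
    exact le_mul_of_one_le_left (norm_nonneg _) (by linarith [Real.pi_gt_three])
  have h2 : 1 + ‖w‖ ≤ (1 + ‖w₀‖) * (1 + ‖(2 * Real.pi) • (w - w₀)‖) := by
    nlinarith [norm_le_norm_add_norm_sub' w w₀, norm_nonneg w₀,
      norm_nonneg ((2 * Real.pi) • (w - w₀))]
  rw [Real.rpow_neg (by positivity), Real.rpow_neg (by positivity), ← div_eq_mul_inv,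
    inv_le_comm₀ (by positivity) (by positivity), inv_div, div_le_iff₀ (by positivity),
    ← Real.mul_rpow (by positivity) (by positivity)]
  exact Real.rpow_le_rpow (by positivity) (by linarith) hN

/-- Rapid decay along the dual lattice gives summability against all powers. -/
lemma summable_mul_norm_latPt_pow {v : Fin d → Euc d} (hv : LinearIndependent ℝ v)
    {c : (Fin d → ℤ) → ℂ}
    (hc : ∀ N : ℝ, 0 ≤ N → ∃ C : ℝ, ∀ m, ‖c m‖ ≤ C * (1 + ‖latPt v m‖) ^ (-N)) (n : ℕ) :
    Summable fun m => ‖c m‖ * ‖latPt v m‖ ^ n := by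
  obtain ⟨C, hC⟩ := hc (n + (d + 1)) (by positivity)
  refine ((summable_one_add_norm_latPt hv).mul_left C).of_nonneg_of_le (fun m => by positivity)
    fun m => ?_
  have hpos : 0 < 1 + ‖latPt v m‖ := by positivity
  calc ‖c m‖ * ‖latPt v m‖ ^ n
      ≤ (C * (1 + ‖latPt v m‖) ^ (-(n + (d + 1) : ℝ))) * (1 + ‖latPt v m‖) ^ n := by
        gcongr
        · exact (norm_nonneg _).trans (hC m)
        · exact hC m
        · linarith
    _ = C * (1 + ‖latPt v m‖) ^ (-(d + 1 : ℝ)) := by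
        rw [mul_assoc, ← Real.rpow_natCast, ← Real.rpow_add hpos]
        congr 2
        ring

/-- The modulated windows `W 0 ξ` have orbit functions as small as the short-time Fourier
transform. -/
lemma norm_apply_compSubConstCLM_le (f : SchwartzMap (Euc d) ℂ →L[ℂ] ℂ)
    (φ : SchwartzMap (Euc d) ℂ) (W : Euc d → Euc d → SchwartzMap (Euc d) ℂ)
    (hW : ∀ x ξ y : Euc d,
      W x ξ y = (starRingEnd ℂ) (φ (y - x)) * Complex.exp (-(Complex.I) * (⟪y, ξ⟫_ℝ : ℂ)))
    (x ξ : Euc d) : ‖f ((W 0 ξ).compSubConstCLM ℂ x)‖ = ‖f (W x ξ)‖ := by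
  have h : (W 0 ξ).compSubConstCLM ℂ x = Complex.exp ((⟪x, ξ⟫_ℝ : ℝ) * Complex.I) • W x ξ := by
    ext y
    change W 0 ξ (y - x) = Complex.exp _ * W x ξ y
    rw [hW, hW, sub_zero, mul_left_comm, ← Complex.exp_add, inner_sub_left]
    congr 2
    push_cast
    ring
  rw [h, map_smul, norm_smul, Complex.norm_exp_ofReal_mul_I, one_mul]

end Decay

/-- if the short-time Fourier transform of an `E`-periodic tempered distribution
decays faster than any negative power of `1+|ξ|`, uniformly in `x`, then the distribution is
given by a smooth `E`-periodic function. Here `W x ξ` is the Schwartz function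
`y ↦ conj(φ(y−x)) e^{-i⟨y,ξ⟩}`, so that `V_φf(x,ξ) = (2π)^{-d/2} f(W x ξ)`. -/
theorem periodic_tempered_distribution_smooth_of_stft_decay
    {d : ℕ} (hd : 1 ≤ d)
    (e : Fin d → Euc d) (he : LinearIndependent ℝ e)
    (f : SchwartzMap (Euc d) ℂ →L[ℂ] ℂ)
    (hper : ∀ (g g' : SchwartzMap (Euc d) ℂ) (k : Fin d → ℤ),
      (∀ y : Euc d, g' y = g (y - latPt e k)) → f g' = f g)
    (φ : SchwartzMap (Euc d) ℂ) (hφne : φ ≠ 0)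
    (W : Euc d → Euc d → SchwartzMap (Euc d) ℂ)
    (hW : ∀ x ξ y : Euc d,
      W x ξ y = (starRingEnd ℂ) (φ (y - x)) * Complex.exp (-(Complex.I) * (⟪y, ξ⟫_ℝ : ℂ)))
    (hdecay : ∀ N : ℝ, 0 ≤ N → ∃ C : ℝ, 0 < C ∧ ∀ x ξ : Euc d,
      ‖(((2 * Real.pi) ^ (-(d:ℝ)/2) : ℝ) : ℂ) * f (W x ξ)‖ ≤ C * (1 + ‖ξ‖) ^ (-N)) :
    ∃ g : Euc d → ℂ, ContDiff ℝ (⊤ : ℕ∞) g ∧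
      (∀ (x : Euc d) (k : Fin d → ℤ), g (x + latPt e k) = g x) ∧
      ∀ ψ : SchwartzMap (Euc d) ℂ, f ψ = ∫ x : Euc d, g x * ψ x := by
  obtain ⟨v, hev, hsum⟩ := exists_dual_basis he
  have hv := linearIndependent_of_inner_eq hev
  have hsurj := torusCoord_surjective hev
  have lift : ∀ ψ : SchwartzMap (Euc d) ℂ, ∃ H : C(UnitAddTorus (Fin d), ℂ),
      ∀ x, H (torusCoord v x) = f (ψ.compSubConstCLM ℂ x) := fun ψ =>
    exists_continuousMap_torusCoord hsum (f.continuous.comp ψ.continuous_compSubConstCLM)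
      fun x k => hper _ _ k fun y => by
        change ψ (y - (x + latPt e k)) = ψ (y - latPt e k - x)
        congr 1
        abel
  choose H hH using lift
  have hχ : W 0 0 ≠ 0 := fun h0 => hφne <| by
    ext y
    have := hW 0 0 y
    rw [h0] at this
    simpa using this.symm
  obtain ⟨w₀, hκ⟩ := SchwartzMap.exists_integral_mul_planeWave_ne_zero hχ
  set κ := ∫ a, W 0 0 a * planeWave w₀ a
  let ρ : (Fin d → ℤ) → SchwartzMap (Euc d) ℂ := fun m =>
    W 0 ((2 * Real.pi) • (latPt v m - w₀))
  have hρ : ∀ m, ∫ a, ρ m a * planeWave (latPt v m) a = κ := fun m => by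
    refine integral_congr_ae (Eventually.of_forall fun a => ?_)
    change ρ m a * planeWave (latPt v m) a = W 0 0 a * planeWave w₀ a
    simp only [ρ, hW, planeWave, mul_assoc, ← Complex.exp_add, inner_smul_right, inner_sub_right,
      inner_zero_right]
    congr 2
    push_cast
    ring
  let c : (Fin d → ℤ) → ℂ := fun m => UnitAddTorus.mFourierCoeff (H (ρ m)) m / κ
  have hcoeff : ∀ ψ m, UnitAddTorus.mFourierCoeff (H ψ) m =
      c m * ∫ a, ψ a * planeWave (latPt v m) a := fun ψ m => by
    have := mFourierCoeff_mul_integral_comm hsurj f (fun ψ => ⟨H ψ, hH ψ⟩) (ρ m) ψ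
      (hH (ρ m)) (hH ψ) m
    rw [hρ] at this
    simp only [c]
    rw [div_mul_eq_mul_div, eq_div_iff hκ, mul_comm, this, mul_comm]
  have hc : ∀ N : ℝ, 0 ≤ N → ∃ C : ℝ, ∀ m, ‖c m‖ ≤ C * (1 + ‖latPt v m‖) ^ (-N) := by
    intro N hN
    obtain ⟨C, hC, hCb⟩ := hdecay N hN
    set K : ℝ := (2 * Real.pi) ^ (-(d:ℝ)/2)
    have hK : 0 < K := by positivity
    refine ⟨C / K * (1 + ‖w₀‖) ^ N / ‖κ‖, fun m => ?_⟩
    have hbound : ‖UnitAddTorus.mFourierCoeff (H (ρ m)) m‖ ≤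
        C / K * ((1 + ‖w₀‖) ^ N * (1 + ‖latPt v m‖) ^ (-N)) := by
      refine norm_mFourierCoeff_le _ (fun t => ?_) m
      obtain ⟨x, rfl⟩ := hsurj t
      rw [hH, norm_apply_compSubConstCLM_le f φ W hW, div_mul_eq_mul_div, le_div_iff₀' hK]
      have h1 := hCb x ((2 * Real.pi) • (latPt v m - w₀))
      rw [norm_mul, Complex.norm_real, Real.norm_of_nonneg hK.le] at h1
      exact h1.trans (mul_le_mul_of_nonneg_left (one_add_norm_sub_rpow_neg_le _ _ hN) hC.le)
    simp only [c]
    rw [norm_div, div_mul_eq_mul_div, mul_assoc]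
    exact div_le_div_of_nonneg_right hbound (norm_nonneg κ)
  have hsummable := summable_mul_norm_latPt_pow hv hc
  have hsummable₀ : Summable fun m => ‖c m‖ := by simpa using hsummable 0
  refine ⟨fun x => ∑' m, c m * planeWave (latPt v m) x, contDiff_tsum_planeWave _ _ hsummable,
    fun x k => by simp only [planeWave_add_latPt hev], fun ψ => ?_⟩
  have hint := ψ.hasSum_integral_tsum_planeWave c (latPt v) hsummable₀
  simp only [← hcoeff] at hint
  have hser := UnitAddTorus.hasSum_mFourier_series_apply_of_summable hint.summable
    (torusCoord v 0)
  simp only [mFourier_torusCoord, hH, smul_eq_mul] at hser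
  have hψ : ψ.compSubConstCLM ℂ 0 = ψ := by
    ext y
    change ψ (y - 0) = ψ y
    rw [sub_zero]
  rw [hψ] at hser
  refine hser.unique ?_
  simpa [planeWave] using hint

end
end

section
/- Let d ≥ 1, s, t > 0 with s + t ≥ 1, E ⊆ ℝ^d be a non-degenerate parallelepiped, and let φ : ℝ^d → ℂ be a nonzero continuous function with |φ(x)| ≤ C₀ e^{-r₀|x|^{1/t}} and |φ̂(ξ)| ≤ C₀ e^{-r₀|ξ|^{1/s}} for some C₀, r₀ > 0. Let a : Λ'_E → ℂ satisfy: for every ε > 0 there is C_ε > 0 with |a(α)| ≤ C_ε e^{ε|α|^{1/s}} for all α, and define F(x,ξ) = e^{-i⟨x,ξ⟩} Σ_{α∈Λ'_E} a(α) conj(φ̂(α−ξ)) e^{i⟨x,α⟩} (the series converges absolutely for every (x,ξ)). Let ψ be a smooth E-periodic function with |c(ψ,α)| ≤ C₁ e^{-r₁|α|^{1/s}} for some C₁, r₁ > 0 and all α ∈ Λ'_E. Then (x,ξ) ↦ F(x,ξ) conj(V_φψ(x,ξ)) belongs to L¹(E × ℝ^d) and Σ_{α∈Λ'_E} a(α)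 conj(c(ψ,α)) = (‖φ‖²_{L²(ℝ^d)} |E|)^{-1} ∫_E ( ∫_{ℝ^d} F(x,ξ) conj(V_φψ(x,ξ)) dξ ) dx, the left-hand side series being absolutely convergent. -/
open MeasureTheory Filter
open scoped BigOperators InnerProductSpace Topology

noncomputable section

/-- The series `F(x,ξ) = e^{-i⟨x,ξ⟩} Σ_{α ∈ Λ'_E} a(α) conj(φ̂(α−ξ)) e^{i⟨x,α⟩}`, which equals
`V_φf(x,ξ)` for the `E`-periodic object `f` with Fourier coefficients `a`. -/
def Fser {d : ℕ} (e' : Fin d → Euc d) (φ : Euc d → ℂ) (a : (Fin d → ℤ) → ℂ)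
    (x ξ : Euc d) : ℂ :=
  Complex.exp (-(Complex.I) * (⟪x, ξ⟫_ℝ : ℂ)) *
    ∑' ι : Fin d → ℤ,
      a ι * (starRingEnd ℂ) (FT φ (latPt e' ι - ξ)) *
        Complex.exp (Complex.I * (⟪x, latPt e' ι⟫_ℝ : ℂ))


namespace ParsevalSTFT

open Complex (I)

variable {d : ℕ} {e e' : Fin d → Euc d}

/-- The coordinate isomorphism `t ↦ ∑ i, t i • e i`. -/
def paraEquiv (he : LinearIndependent ℝ e) : (Fin d → ℝ) ≃L[ℝ] Euc d :=
  (basisOfLinearIndependentOfCardEqFinrank' e he (by simp)).equivFunL.symm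

lemma paraEquiv_apply (he : LinearIndependent ℝ e) (t : Fin d → ℝ) :
    paraEquiv he t = ∑ i, t i • e i := by
  have h := (basisOfLinearIndependentOfCardEqFinrank' e he (by simp)).equivFun_symm_apply t
  rwa [coe_basisOfLinearIndependentOfCardEqFinrank'] at h

lemma latPt_eq_paraEquiv (he : LinearIndependent ℝ e) (j : Fin d → ℤ) :
    latPt e j = paraEquiv he (fun i => (j i : ℝ)) := by
  rw [paraEquiv_apply, latPt]

lemma paraSet_eq_image (he : LinearIndependent ℝ e) :
    paraSet e = paraEquiv he '' Set.Icc 0 1 := by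
  rw [paraSet, ← Set.pi_univ_Icc]
  exact Set.image_congr fun t _ => (paraEquiv_apply he t).symm

lemma isCompact_paraSet (he : LinearIndependent ℝ e) : IsCompact (paraSet e) := by
  rw [paraSet_eq_image he]
  exact isCompact_Icc.image (paraEquiv he).continuous

lemma exists_integral_paraSet (he : LinearIndependent ℝ e) :
    ∃ c : ℝ, ∀ f : Euc d → ℂ,
      ∫ t in Set.Icc (0 : Fin d → ℝ) 1, f (paraEquiv he t) = c * ∫ x in paraSet e, f x := by
  have : (volume.map (paraEquiv he) : Measure (Euc d)).IsAddHaarMeasure :=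
    (paraEquiv he).isAddHaarMeasure_map _
  have hc := Measure.isAddLeftInvariant_eq_smul (volume.map (paraEquiv he)) (volume : Measure (Euc d))
  set c := (volume.map (paraEquiv he)).addHaarScalarFactor (volume : Measure (Euc d))
  refine ⟨c, fun f => ?_⟩
  have hme : MeasurableEmbedding (paraEquiv he) :=
    (paraEquiv he).toHomeomorph.measurableEmbedding
  have h1 : ∫ t in Set.Icc (0 : Fin d → ℝ) 1, f (paraEquiv he t)
      = ∫ x in paraSet e, f x ∂(volume.map (paraEquiv he)) := by
    rw [hme.setIntegral_map, paraSet_eq_image he,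
      Set.preimage_image_eq _ (paraEquiv he).injective]
  rw [h1, hc, Measure.restrict_smul, integral_smul_nnreal_measure]
  simp [NNReal.smul_def]

lemma volume_paraSet_ne_zero (he : LinearIndependent ℝ e) :
    (volume (paraSet e)).toReal ≠ 0 := by
  obtain ⟨c, hc⟩ := exists_integral_paraSet he
  intro h
  have := hc fun _ => 1
  simp [Measure.real, h, Real.volume_Icc_pi] at this

lemma average_paraSet (he : LinearIndependent ℝ e) (f : Euc d → ℂ) :
    ((volume (paraSet e)).toReal : ℂ)⁻¹ * ∫ x in paraSet e, f x =
      ∫ t in Set.Icc (0 : Fin d → ℝ) 1, f (paraEquiv he t) := by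
  obtain ⟨c, hc⟩ := exists_integral_paraSet he
  have h1 := hc fun _ => 1
  simp only [setIntegral_const, Measure.real, Real.volume_Icc_pi] at h1
  simp only [Pi.one_apply, Pi.zero_apply, sub_zero, ENNReal.ofReal_one, Finset.prod_const_one,
    ENNReal.toReal_one, Complex.real_smul, Complex.ofReal_one, mul_one] at h1
  rw [hc f, inv_eq_of_mul_eq_one_left h1.symm]

lemma inner_paraEquiv_latPt (he : LinearIndependent ℝ e)
    (hdual : ∀ j k, ⟪e j, e' k⟫_ℝ = if j = k then 2 * Real.pi else 0)
    (t : Fin d → ℝ) (ι : Fin d → ℤ) :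
    ⟪paraEquiv he t, latPt e' ι⟫_ℝ = ∑ i, 2 * Real.pi * (ι i * t i) := by
  simp only [paraEquiv_apply, latPt, sum_inner, inner_sum, inner_smul_left, inner_smul_right,
    hdual]
  simp
  exact Finset.sum_congr rfl fun i _ => by ring

lemma mFourier_coe_eq_exp (he : LinearIndependent ℝ e)
    (hdual : ∀ j k, ⟪e j, e' k⟫_ℝ = if j = k then 2 * Real.pi else 0)
    (t : Fin d → ℝ) (ι : Fin d → ℤ) :
    UnitAddTorus.mFourier ι (fun i => (t i : UnitAddCircle)) =
      Complex.exp (I * (⟪paraEquiv he t, latPt e' ι⟫_ℝ : ℂ)) := by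
  rw [inner_paraEquiv_latPt he hdual, UnitAddTorus.mFourier, ContinuousMap.coe_mk]
  simp only [fourier_coe_apply, ← Complex.exp_sum]
  congr 1
  push_cast
  rw [Finset.mul_sum]
  exact Finset.sum_congr rfl fun i _ => by ring

lemma latPt_neg (e : Fin d → Euc d) (ι : Fin d → ℤ) : latPt e (-ι) = -latPt e ι := by
  simp [latPt]

lemma fourCoeff_eq_mFourierCoeff (he : LinearIndependent ℝ e)
    (hdual : ∀ j k, ⟪e j, e' k⟫_ℝ = if j = k then 2 * Real.pi else 0)
    {f : Euc d → ℂ} {g : UnitAddTorus (Fin d) → ℂ}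
    (hfg : ∀ t : Fin d → ℝ, g (fun i => (t i : UnitAddCircle)) = f (paraEquiv he t))
    (ι : Fin d → ℤ) :
    fourCoeff e f (latPt e' ι) = UnitAddTorus.mFourierCoeff g ι := by
  rw [fourCoeff, average_paraSet he, UnitAddTorus.mFourierCoeff_eq_integral g ι 0]
  have hset : {x : Fin d → ℝ | ∀ i, x i ∈ Set.Ioc ((0 : Fin d → ℝ) i) ((0 : Fin d → ℝ) i + 1)}
      = Set.univ.pi fun i => Set.Ioc ((0 : Fin d → ℝ) i) ((1 : Fin d → ℝ) i) := by
    ext; simp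
  rw [hset, volume_pi, setIntegral_congr_set Measure.univ_pi_Ioc_ae_eq_Icc]
  congr 1 with t
  rw [mFourier_coe_eq_exp he hdual, hfg, latPt_neg, inner_neg_right, smul_eq_mul, mul_comm]
  simp

lemma isOpenQuotientMap_torus_mk :
    IsOpenQuotientMap (Pi.map fun _ (x : ℝ) => (x : UnitAddCircle) :
      (Fin d → ℝ) → UnitAddTorus (Fin d)) :=
  IsOpenQuotientMap.piMap fun _ => QuotientAddGroup.isOpenQuotientMap_mk

lemma exists_torus_lift (he : LinearIndependent ℝ e) {f : Euc d → ℂ} (hf : Continuous f)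
    (hper : ∀ (x : Euc d) (j : Fin d → ℤ), f (x + latPt e j) = f x) :
    ∃ g : C(UnitAddTorus (Fin d), ℂ),
      ∀ t : Fin d → ℝ, g (fun i => (t i : UnitAddCircle)) = f (paraEquiv he t) := by
  have hq := isOpenQuotientMap_torus_mk (d := d)
  let g : UnitAddTorus (Fin d) → ℂ := fun z => f (paraEquiv he (Function.surjInv hq.surjective z))
  have hg : ∀ t : Fin d → ℝ, g (Pi.map (fun _ (x : ℝ) => (x : UnitAddCircle)) t) =
      f (paraEquiv he t) := by
    intro t
    have h := Function.surjInv_eq hq.surjective (Pi.map (fun _ (x : ℝ) => (x : UnitAddCircle)) t)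
    set u := Function.surjInv hq.surjective (Pi.map (fun _ (x : ℝ) => (x : UnitAddCircle)) t)
    have h' : ∀ i, ∃ n : ℤ, u i = t i + n := by
      intro i
      have hi : ((u i : ℝ) : UnitAddCircle) = (t i : UnitAddCircle) := congrFun h i
      rw [← sub_eq_zero, ← AddCircle.coe_sub, AddCircle.coe_eq_zero_iff] at hi
      obtain ⟨n, hn⟩ := hi
      exact ⟨n, by simp at hn; linarith⟩
    choose n hn using h'
    have hu : u = t + fun i => (n i : ℝ) := funext hn
    change f (paraEquiv he u) = _
    rw [hu, map_add, ← latPt_eq_paraEquiv, hper]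
  refine ⟨⟨g, hq.continuous_comp_iff.1 ?_⟩, hg⟩
  simpa only [Function.comp_def, hg] using hf.comp (paraEquiv he).continuous

lemma hasSum_fourCoeff (he : LinearIndependent ℝ e)
    (hdual : ∀ j k, ⟪e j, e' k⟫_ℝ = if j = k then 2 * Real.pi else 0)
    {f : Euc d → ℂ} (hf : Continuous f)
    (hper : ∀ (x : Euc d) (j : Fin d → ℤ), f (x + latPt e j) = f x)
    (hsum : Summable fun ι => fourCoeff e f (latPt e' ι)) (x : Euc d) :
    HasSum (fun ι => fourCoeff e f (latPt e' ι) * Complex.exp (I * (⟪x, latPt e' ι⟫_ℝ : ℂ)))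
      (f x) := by
  obtain ⟨g, hg⟩ := exists_torus_lift he hf hper
  obtain ⟨t, rfl⟩ := (paraEquiv he).surjective x
  simp only [fourCoeff_eq_mFourierCoeff he hdual hg, ← mFourier_coe_eq_exp he hdual, ← hg] at hsum ⊢
  exact UnitAddTorus.hasSum_mFourier_series_apply_of_summable hsum _

lemma mFourierCoeff_mFourier (ι κ : Fin d → ℤ) :
    UnitAddTorus.mFourierCoeff (UnitAddTorus.mFourier ι) κ = if ι = κ then 1 else 0 := by
  have h := UnitAddTorus.mFourierCoeff_toLp (f := UnitAddTorus.mFourier ι) κ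
  rw [← h, ← UnitAddTorus.mFourierBasis_repr]
  change UnitAddTorus.mFourierBasis.repr (UnitAddTorus.mFourierLp 2 ι) κ = _
  rw [← UnitAddTorus.coe_mFourierBasis, HilbertBasis.repr_self, lp.single_apply]
  simp [Pi.single_apply, eq_comm]

lemma integral_exp_mul_exp (he : LinearIndependent ℝ e)
    (hdual : ∀ j k, ⟪e j, e' k⟫_ℝ = if j = k then 2 * Real.pi else 0) (ι κ : Fin d → ℤ) :
    ∫ x in paraSet e, Complex.exp (I * (⟪x, latPt e' ι⟫_ℝ : ℂ)) *
      Complex.exp (-I * (⟪x, latPt e' κ⟫_ℝ : ℂ)) =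
      if ι = κ then ((volume (paraSet e)).toReal : ℂ) else 0 := by
  have h := fourCoeff_eq_mFourierCoeff he hdual (fun t => mFourier_coe_eq_exp he hdual t ι) κ
    (f := fun x => Complex.exp (I * (⟪x, latPt e' ι⟫_ℝ : ℂ)))
  rw [mFourierCoeff_mFourier, fourCoeff] at h
  have h0 : ((volume (paraSet e)).toReal : ℂ) ≠ 0 :=
    Complex.ofReal_ne_zero.2 (volume_paraSet_ne_zero he)
  rw [inv_mul_eq_iff_eq_mul₀ h0] at h
  rw [h]; simp

open scoped FourierTransform ComplexConjugate

lemma exists_exp_neg_rpow_le {ε p : ℝ} (hε : 0 < ε) (hp : 0 < p) (N : ℕ) :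
    ∃ C : ℝ, 0 < C ∧ ∀ u : ℝ, 0 ≤ u →
      Real.exp (-ε * u ^ p) ≤ C * (1 + u) ^ (-(N : ℝ)) := by
  obtain ⟨n, hn⟩ := exists_nat_ge ((N : ℝ) / p)
  rw [div_le_iff₀ hp] at hn
  refine ⟨2 ^ N * (1 + n.factorial / ε ^ n), by positivity, fun u hu => ?_⟩
  have hv : 0 ≤ u ^ p := Real.rpow_nonneg hu p
  rw [Real.rpow_neg (by positivity), Real.rpow_natCast, ← div_eq_mul_inv,
    le_div_iff₀ (by positivity)]
  have hfac : 0 ≤ (n.factorial : ℝ) / ε ^ n := by positivity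
  rcases le_total u 1 with h1 | h1
  · have hexp : Real.exp (-ε * u ^ p) ≤ 1 := Real.exp_le_one_iff.2 (by nlinarith)
    have hpow : (1 + u) ^ N ≤ 2 ^ N := pow_le_pow_left₀ (by positivity) (by linarith) N
    calc Real.exp (-ε * u ^ p) * (1 + u) ^ N ≤ 1 * 2 ^ N := by gcongr
      _ ≤ 2 ^ N * (1 + n.factorial / ε ^ n) := by nlinarith [pow_pos (two_pos (α := ℝ)) N]
  · have hpow : (1 + u) ^ N ≤ 2 ^ N * u ^ N := by
      rw [← mul_pow]
      exact pow_le_pow_left₀ (by positivity) (by linarith) N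
    have hun : u ^ N ≤ (u ^ p) ^ n := by
      rw [← Real.rpow_natCast, ← Real.rpow_natCast, ← Real.rpow_mul hu]
      exact Real.rpow_le_rpow_of_exponent_le h1 (by linarith)
    have hexp := Real.pow_div_factorial_le_exp (ε * u ^ p) (by positivity) n
    have key : Real.exp (-ε * u ^ p) * (u ^ p) ^ n ≤ n.factorial / ε ^ n := by
      rw [neg_mul, Real.exp_neg, inv_mul_le_iff₀ (Real.exp_pos _)]
      calc (u ^ p) ^ n = (ε * u ^ p) ^ n / n.factorial * (n.factorial / ε ^ n) := by
            rw [mul_pow]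
            field_simp
        _ ≤ _ := by gcongr
    calc Real.exp (-ε * u ^ p) * (1 + u) ^ N
        ≤ Real.exp (-ε * u ^ p) * (2 ^ N * (u ^ p) ^ n) := by gcongr; exact hpow.trans (by gcongr)
      _ = 2 ^ N * (Real.exp (-ε * u ^ p) * (u ^ p) ^ n) := by ring
      _ ≤ 2 ^ N * (1 + n.factorial / ε ^ n) := by gcongr; linarith

lemma integrable_exp_neg_rpow {ε p : ℝ} (hε : 0 < ε) (hp : 0 < p) :
    Integrable fun x : Euc d => Real.exp (-ε * ‖x‖ ^ p) := by
  obtain ⟨C, -, hC⟩ := exists_exp_neg_rpow_le hε hp (d + 1)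
  have h_int : Integrable fun x : Euc d => (1 + ‖x‖) ^ (-((d + 1 : ℕ) : ℝ)) :=
    integrable_one_add_norm (by simp)
  refine (h_int.const_mul C).mono' (Measurable.aestronglyMeasurable (by fun_prop)) ?_
  exact Eventually.of_forall fun x => by
    rw [Real.norm_of_nonneg (Real.exp_pos _).le]
    exact hC _ (norm_nonneg x)

lemma linearIndependent_dual
    (hdual : ∀ j k, ⟪e j, e' k⟫_ℝ = if j = k then 2 * Real.pi else 0) :
    LinearIndependent ℝ e' := by
  rw [Fintype.linearIndependent_iff]
  intro g hg i
  have h := congrArg (fun v => ⟪e i, v⟫_ℝ) hg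
  simpa [inner_sum, inner_smul_right, hdual, Real.pi_ne_zero] using h

lemma summable_exp_neg_latPt (he' : LinearIndependent ℝ e') {ε p : ℝ} (hε : 0 < ε) (hp : 0 < p) :
    Summable fun ι : Fin d → ℤ => Real.exp (-ε * ‖latPt e' ι‖ ^ p) := by
  let b := basisOfLinearIndependentOfCardEqFinrank' e' he' (by simp)
  let Λ : Submodule ℤ (Euc d) := Submodule.span ℤ (Set.range b)
  have hmem : ∀ ι : Fin d → ℤ, latPt e' ι ∈ Λ := fun ι => by
    refine Submodule.sum_mem _ fun i _ => ?_
    rw [Int.cast_smul_eq_zsmul]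
    refine Submodule.smul_mem _ _ (Submodule.subset_span ⟨i, ?_⟩)
    simp [b]
  have hinj : Function.Injective fun ι : Fin d → ℤ => (⟨latPt e' ι, hmem ι⟩ : Λ) := by
    intro ι κ h
    have h' : latPt e' ι = latPt e' κ := congrArg Subtype.val h
    rw [latPt_eq_paraEquiv he', latPt_eq_paraEquiv he'] at h'
    funext i
    exact_mod_cast congrFun ((paraEquiv he').injective h') i
  obtain ⟨C, hC0, hC⟩ := exists_exp_neg_rpow_le hε hp (Module.finrank ℤ Λ + 1)
  have hsum := (ZLattice.summable_norm_rpow Λ (-((Module.finrank ℤ Λ + 1 : ℕ) : ℝ))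
    (by push_cast; linarith)).comp_injective hinj
  have hev : ∀ᶠ ι : Fin d → ℤ in cofinite, latPt e' ι ≠ 0 := by
    have : {ι : Fin d → ℤ | ¬ latPt e' ι ≠ 0}.Subsingleton := fun ι h κ h' =>
      hinj (Subtype.ext ((not_not.1 h).trans (not_not.1 h').symm))
    exact this.finite
  refine (hsum.mul_left C).of_norm_bounded_eventually ?_
  filter_upwards [hev] with ι hι
  rw [Real.norm_of_nonneg (Real.exp_pos _).le]
  refine (hC _ (norm_nonneg _)).trans ?_
  refine mul_le_mul_of_nonneg_left ?_ hC0.le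
  change _ ≤ ‖latPt e' ι‖ ^ (-((Module.finrank ℤ Λ + 1 : ℕ) : ℝ))
  exact Real.rpow_le_rpow_of_nonpos (norm_pos_iff.2 hι) (by linarith [norm_nonneg (latPt e' ι)])
    (by rw [neg_nonpos]; positivity)

lemma norm_exp_neg_I_mul (r : ℝ) : ‖Complex.exp (-I * (r : ℂ))‖ = 1 := by
  rw [neg_mul, mul_comm, ← neg_mul, ← Complex.ofReal_neg, Complex.norm_exp_ofReal_mul_I]

lemma norm_exp_I_mul (r : ℝ) : ‖Complex.exp (I * (r : ℂ))‖ = 1 := by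
  rw [mul_comm, Complex.norm_exp_ofReal_mul_I]

lemma conj_exp_I_mul (r : ℝ) :
    conj (Complex.exp (I * (r : ℂ))) = Complex.exp (-I * (r : ℂ)) := by
  rw [← Complex.exp_conj]; simp

lemma conj_exp_neg_I_mul (r : ℝ) :
    conj (Complex.exp (-I * (r : ℂ))) = Complex.exp (I * (r : ℂ)) := by
  rw [← Complex.exp_conj]; simp

lemma FT_eq_fourier (f : Euc d → ℂ) (ξ : Euc d) :
    FT f ξ = (((2 * Real.pi) ^ (-(d : ℝ) / 2) : ℝ) : ℂ) * 𝓕 f ((2 * Real.pi)⁻¹ • ξ) := by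
  rw [FT, Real.fourier_eq']
  congr 2 with x
  rw [inner_smul_right, smul_eq_mul, mul_comm]
  congr 2
  push_cast
  have : (Real.pi : ℂ) ≠ 0 := Complex.ofReal_ne_zero.2 Real.pi_ne_zero
  field_simp

lemma continuous_fourier {f : Euc d → ℂ} (hf : Integrable f) : Continuous (𝓕 f) :=
  VectorFourier.fourierIntegral_continuous Real.continuous_fourierChar continuous_inner hf

lemma continuous_FT {f : Euc d → ℂ} (hf : Integrable f) : Continuous (FT f) := by
  have h := continuous_fourier hf
  simp only [funext (FT_eq_fourier f)]
  fun_prop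

lemma integral_norm_sq_fourier {f : Euc d → ℂ} (hc : Continuous f) (hf : Integrable f)
    (hf' : Integrable (𝓕 f)) : ∫ ξ, ‖𝓕 f ξ‖ ^ 2 = ∫ x, ‖f x‖ ^ 2 := by
  have h := VectorFourier.integral_sesq_fourierIntegral_eq_neg_flip (innerSL ℂ (E := ℂ))
    (L := innerₗ (Euc d)) Real.continuous_fourierChar continuous_inner hf hf'
  have hinv : ∀ x, VectorFourier.fourierIntegral Real.fourierChar volume
      (-(innerₗ (Euc d)).flip) (𝓕 f) x = f x := by
    intro x
    conv_rhs => rw [← hc.fourierInv_fourier_eq hf hf']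
    rw [Real.fourierInv_eq]
    simp [VectorFourier.fourierIntegral, real_inner_comm]
  simp only [hinv] at h
  have h' : ∫ ξ, ((‖𝓕 f ξ‖ ^ 2 : ℝ) : ℂ) = ∫ x, ((‖f x‖ ^ 2 : ℝ) : ℂ) := by
    refine Eq.trans (integral_congr_ae (Eventually.of_forall fun ξ => ?_))
      (h.trans (integral_congr_ae (Eventually.of_forall fun ξ => ?_)))
    · change _ = inner ℂ (𝓕 f ξ) (𝓕 f ξ)
      rw [inner_self_eq_norm_sq_to_K]; push_cast; rfl
    · change inner ℂ (f ξ) (f ξ) = _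
      rw [inner_self_eq_norm_sq_to_K]; push_cast; rfl
  rw [integral_complex_ofReal, integral_complex_ofReal] at h'
  exact_mod_cast h'

lemma integral_norm_sq_FT {f : Euc d → ℂ} (hc : Continuous f) (hf : Integrable f)
    (hf' : Integrable (FT f)) : ∫ ξ, ‖FT f ξ‖ ^ 2 = ∫ x, ‖f x‖ ^ 2 := by
  have hpi : (0 : ℝ) < 2 * Real.pi := by positivity
  have h_int : Integrable (𝓕 f) := by
    have h0 : (((2 * Real.pi) ^ (-(d : ℝ) / 2) : ℝ) : ℂ) ≠ 0 :=
      Complex.ofReal_ne_zero.2 (by positivity)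
    simp only [funext (FT_eq_fourier f)] at hf'
    rw [integrable_const_mul_iff (IsUnit.mk0 _ h0)] at hf'
    exact (integrable_comp_smul_iff volume (𝓕 f) (inv_ne_zero hpi.ne')).1 hf'
  rw [← integral_norm_sq_fourier hc hf h_int]
  simp only [FT_eq_fourier, norm_mul, mul_pow, integral_const_mul, Complex.norm_real]
  rw [Measure.integral_comp_smul volume (fun ξ => ‖𝓕 f ξ‖ ^ 2) (2 * Real.pi)⁻¹, smul_eq_mul,
    ← mul_assoc]
  convert one_mul _
  rw [finrank_euclideanSpace_fin, Real.norm_of_nonneg (by positivity), ← Real.rpow_natCast,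
    ← Real.rpow_mul hpi.le, inv_pow, inv_inv, abs_of_pos (by positivity),
    ← Real.rpow_natCast, ← Real.rpow_add hpi]
  simp

lemma STFT_eq_Fser {φ : Euc d → ℂ} (hφ : Integrable φ) {ψ : Euc d → ℂ} {c : (Fin d → ℤ) → ℂ}
    (hc : Summable fun ι => ‖c ι‖)
    (hψ : ∀ x, HasSum (fun ι => c ι * Complex.exp (I * (⟪x, latPt e' ι⟫_ℝ : ℂ))) (ψ x))
    (x ξ : Euc d) : STFT φ ψ x ξ = Fser e' φ c x ξ := by
  have hshift : STFT φ ψ x ξ = (((2 * Real.pi) ^ (-(d : ℝ) / 2) : ℝ) : ℂ) *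
      ∫ y, ψ (y + x) * conj (φ y) * Complex.exp (-I * (⟪y + x, ξ⟫_ℝ : ℂ)) := by
    rw [STFT, ← integral_add_right_eq_self _ x]
    simp only [add_sub_cancel_right]
  let T : (Fin d → ℤ) → Euc d → ℂ := fun ι y =>
    c ι * Complex.exp (I * (⟪y + x, latPt e' ι⟫_ℝ : ℂ)) * conj (φ y) *
      Complex.exp (-I * (⟪y + x, ξ⟫_ℝ : ℂ))
  have hT : ∀ ι y, ‖T ι y‖ = ‖c ι‖ * ‖φ y‖ := fun ι y => by
    simp only [T, norm_mul, norm_exp_I_mul, norm_exp_neg_I_mul, RCLike.norm_conj, mul_one]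
  have hTint : ∀ ι, Integrable (T ι) := fun ι => by
    refine (hφ.norm.const_mul ‖c ι‖).mono' ?_ (Eventually.of_forall fun y => (hT ι y).le)
    have hφm := Complex.continuous_conj.comp_aestronglyMeasurable hφ.aestronglyMeasurable
    refine AEStronglyMeasurable.mul (AEStronglyMeasurable.mul ?_ hφm) ?_
    · exact Continuous.aestronglyMeasurable (by fun_prop)
    · exact Continuous.aestronglyMeasurable (by fun_prop)
  have hTsum : Summable fun ι => ∫ y, ‖T ι y‖ := by
    simp only [hT, integral_const_mul]
    exact hc.mul_right _
  have h := hasSum_integral_of_summable_integral_norm hTint hTsum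
  have htsum : ∀ y, ∑' ι, T ι y =
      ψ (y + x) * conj (φ y) * Complex.exp (-I * (⟪y + x, ξ⟫_ℝ : ℂ)) := fun y =>
    (((hψ (y + x)).mul_right _).mul_right _).tsum_eq
  simp only [htsum] at h
  rw [hshift, ← h.tsum_eq, ← tsum_mul_left, Fser, ← tsum_mul_left]
  refine tsum_congr fun ι => ?_
  rw [FT, map_mul, Complex.conj_ofReal, ← integral_conj]
  have hTι : ∀ y, T ι y = (c ι * Complex.exp (I * (⟪x, latPt e' ι⟫_ℝ : ℂ)) *
      Complex.exp (-I * (⟪x, ξ⟫_ℝ : ℂ))) *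
      conj (φ y * Complex.exp (-I * (⟪y, latPt e' ι - ξ⟫_ℝ : ℂ))) := fun y => by
    simp only [T, map_mul, conj_exp_neg_I_mul, inner_add_left, inner_sub_right]
    push_cast
    simp only [mul_add, mul_sub, Complex.exp_add, Complex.exp_sub, neg_mul, Complex.exp_neg]
    field_simp
  simp only [hTι, integral_const_mul]
  ring

lemma rpow_add_le {x y p : ℝ} (hx : 0 ≤ x) (hy : 0 ≤ y) (hp : 0 < p) :
    (x + y) ^ p ≤ 2 ^ p * (x ^ p + y ^ p) := by
  have hx' := Real.rpow_nonneg hx p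
  have hy' := Real.rpow_nonneg hy p
  calc (x + y) ^ p ≤ (2 * max x y) ^ p :=
        Real.rpow_le_rpow (by positivity)
          (by linarith [le_max_left x y, le_max_right x y]) hp.le
    _ = 2 ^ p * max x y ^ p := Real.mul_rpow two_pos.le (le_max_of_le_left hx)
    _ ≤ 2 ^ p * (x ^ p + y ^ p) := by
        gcongr
        rcases max_choice x y with h | h <;> rw [h] <;> linarith

lemma norm_rpow_le_of_sub {V : Type*} [SeminormedAddCommGroup V] {p : ℝ} (hp : 0 < p) (v w : V) :
    ‖v‖ ^ p ≤ 2 ^ p * (‖v - w‖ ^ p + ‖w‖ ^ p) :=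
  (Real.rpow_le_rpow (norm_nonneg v) (by simpa using norm_add_le (v - w) w) hp.le).trans
    (rpow_add_le (norm_nonneg _) (norm_nonneg _) hp)

lemma exists_bound_of_subexponential {p r₀ C₀ δ : ℝ} (hp : 0 < p) (hr₀ : 0 < r₀) (hC₀ : 0 < C₀)
    (hδ : 0 < δ) {a : (Fin d → ℤ) → ℂ}
    (ha : ∀ ε : ℝ, 0 < ε → ∃ Cε : ℝ, 0 < Cε ∧ ∀ ι : Fin d → ℤ,
      ‖a ι‖ ≤ Cε * Real.exp (ε * ‖latPt e' ι‖ ^ p))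
    {Φ : Euc d → ℂ} (hΦ : ∀ ξ, ‖Φ ξ‖ ≤ C₀ * Real.exp (-r₀ * ‖ξ‖ ^ p)) :
    ∃ C ε : ℝ, 0 < C ∧ 0 < ε ∧ ∀ ι ξ, ‖a ι * conj (Φ (latPt e' ι - ξ))‖ ≤
      C * Real.exp (-ε * ‖latPt e' ι‖ ^ p) * Real.exp (δ * ‖ξ‖ ^ p) := by
  have h2 : (0 : ℝ) < 2 ^ p := by positivity
  have hm : 0 < min r₀ δ := lt_min hr₀ hδ
  obtain ⟨ε, hε⟩ : ∃ ε, ε = min r₀ δ / (2 * 2 ^ p) := ⟨_, rfl⟩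
  have hε0 : 0 < ε := hε ▸ by positivity
  obtain ⟨Cε, hCε, hCa⟩ := ha ε hε0
  refine ⟨Cε * C₀, ε, by positivity, hε0, fun ι ξ => ?_⟩
  rw [norm_mul, RCLike.norm_conj]
  refine (mul_le_mul (hCa ι) (hΦ _) (norm_nonneg _) (by positivity)).trans ?_
  rw [mul_mul_mul_comm, mul_assoc (Cε * C₀), ← Real.exp_add, ← Real.exp_add]
  refine mul_le_mul_of_nonneg_left (Real.exp_le_exp.2 ?_) (by positivity)
  have h := norm_rpow_le_of_sub hp (latPt e' ι) ξ
  have hA : 0 ≤ ‖latPt e' ι - ξ‖ ^ p := by positivity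
  have hX : 0 ≤ ‖ξ‖ ^ p := by positivity
  have h' : 2 * ε * ‖latPt e' ι‖ ^ p ≤ min r₀ δ * (‖latPt e' ι - ξ‖ ^ p + ‖ξ‖ ^ p) := by
    calc _ ≤ 2 * ε * (2 ^ p * (‖latPt e' ι - ξ‖ ^ p + ‖ξ‖ ^ p)) := by gcongr
      _ = _ := by rw [hε]; field_simp
  have h1 := mul_le_mul_of_nonneg_right (min_le_left r₀ δ) hA
  have h3 := mul_le_mul_of_nonneg_right (min_le_right r₀ δ) hX
  linarith

lemma exists_bound_of_exponential {p r₀ C₀ r₁ C₁ : ℝ} (hp : 0 < p) (hr₀ : 0 < r₀) (hC₀ : 0 < C₀)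
    (hr₁ : 0 < r₁) (hC₁ : 0 < C₁) {c : (Fin d → ℤ) → ℂ}
    (hc : ∀ ι, ‖c ι‖ ≤ C₁ * Real.exp (-r₁ * ‖latPt e' ι‖ ^ p))
    {Φ : Euc d → ℂ} (hΦ : ∀ ξ, ‖Φ ξ‖ ≤ C₀ * Real.exp (-r₀ * ‖ξ‖ ^ p)) :
    ∃ C ε δ : ℝ, 0 < C ∧ 0 < ε ∧ 0 < δ ∧ ∀ ι ξ, ‖c ι * conj (Φ (latPt e' ι - ξ))‖ ≤
      C * Real.exp (-ε * ‖latPt e' ι‖ ^ p) * Real.exp (-δ * ‖ξ‖ ^ p) := by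
  have h2 : (0 : ℝ) < 2 ^ p := by positivity
  have hm : 0 < min r₀ (r₁ / 2) := lt_min hr₀ (by positivity)
  obtain ⟨δ, hδ⟩ : ∃ δ, δ = min r₀ (r₁ / 2) / 2 ^ p := ⟨_, rfl⟩
  have hδ0 : 0 < δ := hδ ▸ by positivity
  refine ⟨C₁ * C₀, r₁ / 2, δ, by positivity, by positivity, hδ0, fun ι ξ => ?_⟩
  rw [norm_mul, RCLike.norm_conj]
  refine (mul_le_mul (hc ι) (hΦ _) (norm_nonneg _) (by positivity)).trans ?_
  rw [mul_mul_mul_comm, mul_assoc (C₁ * C₀), ← Real.exp_add, ← Real.exp_add]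
  refine mul_le_mul_of_nonneg_left (Real.exp_le_exp.2 ?_) (by positivity)
  have h := norm_rpow_le_of_sub hp ξ (latPt e' ι)
  rw [norm_sub_rev] at h
  have hA : 0 ≤ ‖latPt e' ι - ξ‖ ^ p := by positivity
  have hX : 0 ≤ ‖latPt e' ι‖ ^ p := by positivity
  have h' : δ * ‖ξ‖ ^ p ≤
      min r₀ (r₁ / 2) * (‖latPt e' ι - ξ‖ ^ p + ‖latPt e' ι‖ ^ p) := by
    calc _ ≤ δ * (2 ^ p * (‖latPt e' ι - ξ‖ ^ p + ‖latPt e' ι‖ ^ p)) := by gcongr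
      _ = _ := by rw [hδ]; field_simp
  have h1 := mul_le_mul_of_nonneg_right (min_le_left r₀ (r₁ / 2)) hA
  have h3 := mul_le_mul_of_nonneg_right (min_le_right r₀ (r₁ / 2)) hX
  linarith

/-- The general term of the series defining `Fser`, including the phase factor. -/
def FserTerm (e' : Fin d → Euc d) (φ : Euc d → ℂ) (a : (Fin d → ℤ) → ℂ) (ι : Fin d → ℤ)
    (x ξ : Euc d) : ℂ :=
  Complex.exp (-I * (⟪x, ξ⟫_ℝ : ℂ)) * (a ι * conj (FT φ (latPt e' ι - ξ)) *
    Complex.exp (I * (⟪x, latPt e' ι⟫_ℝ : ℂ)))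

lemma tsum_FserTerm (φ : Euc d → ℂ) (a : (Fin d → ℤ) → ℂ) (x ξ : Euc d) :
    ∑' ι, FserTerm e' φ a ι x ξ = Fser e' φ a x ξ := tsum_mul_left

lemma norm_FserTerm (φ : Euc d → ℂ) (a : (Fin d → ℤ) → ℂ) (ι : Fin d → ℤ) (x ξ : Euc d) :
    ‖FserTerm e' φ a ι x ξ‖ = ‖a ι * conj (FT φ (latPt e' ι - ξ))‖ := by
  rw [FserTerm, norm_mul, norm_exp_neg_I_mul, norm_mul _ (Complex.exp _), norm_exp_I_mul,
    one_mul, mul_one]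

lemma continuous_FserTerm {φ : Euc d → ℂ} (hφ : Continuous (FT φ)) (a : (Fin d → ℤ) → ℂ)
    (ι : Fin d → ℤ) : Continuous fun q : Euc d × Euc d => FserTerm e' φ a ι q.1 q.2 := by
  unfold FserTerm
  have := Complex.continuous_conj
  fun_prop

lemma integral_FserTerm_mul_conj_Fser (he : LinearIndependent ℝ e)
    (hdual : ∀ j k, ⟪e j, e' k⟫_ℝ = if j = k then 2 * Real.pi else 0)
    {φ : Euc d → ℂ} {a c : (Fin d → ℤ) → ℂ} (ι : Fin d → ℤ) (ξ : Euc d)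
    (hc : Summable fun κ => ‖c κ * conj (FT φ (latPt e' κ - ξ))‖) :
    ∫ x in paraSet e, FserTerm e' φ a ι x ξ * conj (Fser e' φ c x ξ) =
      a ι * conj (c ι) * (volume (paraSet e)).toReal *
        ((‖FT φ (latPt e' ι - ξ)‖ ^ 2 : ℝ) : ℂ) := by
  let m : (Fin d → ℤ) → ℂ := fun κ =>
    a ι * conj (FT φ (latPt e' ι - ξ)) * conj (c κ * conj (FT φ (latPt e' κ - ξ)))
  let T : (Fin d → ℤ) → Euc d → ℂ := fun κ x => m κ *
    (Complex.exp (I * (⟪x, latPt e' ι⟫_ℝ : ℂ)) * Complex.exp (-I * (⟪x, latPt e' κ⟫_ℝ : ℂ)))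
  have hfin : IsFiniteMeasure (volume.restrict (paraSet e)) :=
    isFiniteMeasure_restrict.2 (isCompact_paraSet he).measure_lt_top.ne
  have hTn : ∀ κ x, ‖T κ x‖ = ‖m κ‖ := fun κ x => by
    simp only [T, norm_mul, norm_exp_I_mul, norm_exp_neg_I_mul, mul_one]
  have hTint : ∀ κ, IntegrableOn (T κ) (paraSet e) := fun κ =>
    (integrable_const ‖m κ‖).mono' (Continuous.aestronglyMeasurable (by fun_prop))
      (Eventually.of_forall fun x => (hTn κ x).le)
  have hTsum : Summable fun κ => ∫ x in paraSet e, ‖T κ x‖ := by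
    simp only [hTn, integral_const, smul_eq_mul]
    refine Summable.mul_left _ ?_
    simp only [m, norm_mul (a ι * _), RCLike.norm_conj]
    exact hc.mul_left _
  have h := hasSum_integral_of_summable_integral_norm hTint hTsum
  have hT : ∀ x, ∑' κ, T κ x = FserTerm e' φ a ι x ξ * conj (Fser e' φ c x ξ) := fun x => by
    rw [← tsum_FserTerm, Complex.conj_tsum, ← tsum_mul_left]
    refine tsum_congr fun κ => ?_
    simp only [T, m, FserTerm, map_mul, conj_exp_neg_I_mul, conj_exp_I_mul, Complex.conj_conj]
    have hunit : Complex.exp (-I * (⟪x, ξ⟫_ℝ : ℂ)) * Complex.exp (I * (⟪x, ξ⟫_ℝ : ℂ)) = 1 := by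
      rw [← Complex.exp_add]; simp
    linear_combination (-(a ι * conj (FT φ (latPt e' ι - ξ)) * (conj (c κ) *
      FT φ (latPt e' κ - ξ)) * (Complex.exp (I * (⟪x, latPt e' ι⟫_ℝ : ℂ)) *
      Complex.exp (-I * (⟪x, latPt e' κ⟫_ℝ : ℂ))))) * hunit
  simp only [hT] at h
  rw [← h.tsum_eq, tsum_eq_single ι]
  · simp only [T, integral_const_mul, integral_exp_mul_exp he hdual, if_true, m, map_mul,
      Complex.conj_conj]
    have := Complex.conj_mul' (FT φ (latPt e' ι - ξ))
    push_cast
    rw [← this]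
    ring
  · intro κ hκ
    simp only [T, integral_const_mul, integral_exp_mul_exp he hdual, if_neg hκ.symm, mul_zero]

/-- Parseval's identity for the short-time Fourier transform, in terms of the two coefficient
families and under explicit domination of their `Fser` series. -/
theorem parseval_Fser (he : LinearIndependent ℝ e)
    (hdual : ∀ j k, ⟪e j, e' k⟫_ℝ = if j = k then 2 * Real.pi else 0)
    {φ : Euc d → ℂ} (hΦ : Continuous (FT φ)) {a c : (Fin d → ℤ) → ℂ}
    {A B : (Fin d → ℤ) → ℝ} {W U : Euc d → ℝ} {K : ℝ} (hA : Summable A) (hB : Summable B)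
    (hA0 : ∀ ι, 0 ≤ A ι) (hB0 : ∀ ι, 0 ≤ B ι) (hW0 : ∀ ξ, 0 ≤ W ξ)
    (haW : ∀ ι ξ, ‖a ι * conj (FT φ (latPt e' ι - ξ))‖ ≤ A ι * W ξ)
    (hcU : ∀ ι ξ, ‖c ι * conj (FT φ (latPt e' ι - ξ))‖ ≤ B ι * U ξ)
    (hU : ∀ ξ, U ξ ≤ 1) (hWU : Integrable fun ξ => W ξ * U ξ) (hK : ∀ ξ, W ξ * U ξ ≤ K) :
    IntegrableOn (fun q : Euc d × Euc d => Fser e' φ a q.1 q.2 * conj (Fser e' φ c q.1 q.2))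
        (paraSet e ×ˢ Set.univ) ∧
      ∫ x in paraSet e, ∫ ξ, Fser e' φ a x ξ * conj (Fser e' φ c x ξ) =
        ((∫ ξ, ‖FT φ ξ‖ ^ 2) * (volume (paraSet e)).toReal : ℝ) *
          ∑' ι, a ι * conj (c ι) := by
  have hfin : IsFiniteMeasure (volume.restrict (paraSet e)) :=
    isFiniteMeasure_restrict.2 (isCompact_paraSet he).measure_lt_top.ne
  have hcsum : ∀ x ξ, Summable fun ι => ‖FserTerm e' φ c ι x ξ‖ := fun x ξ =>
    (hB.mul_right (U ξ)).of_nonneg_of_le (fun _ => norm_nonneg _)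
      fun ι => (norm_FserTerm φ c ι x ξ).trans_le (hcU ι ξ)
  have hVc : Continuous fun q : Euc d × Euc d => Fser e' φ c q.1 q.2 := by
    simp only [← tsum_FserTerm]
    refine continuous_tsum (continuous_FserTerm hΦ c) hB fun ι q => ?_
    rw [norm_FserTerm]
    exact (hcU ι q.2).trans (mul_le_of_le_one_right (hB0 ι) (hU _))
  have hV : ∀ x ξ, ‖Fser e' φ c x ξ‖ ≤ (∑' ι, B ι) * U ξ := fun x ξ => by
    rw [← tsum_FserTerm, ← tsum_mul_right]
    exact (norm_tsum_le_tsum_norm (hcsum x ξ)).trans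
      ((hcsum x ξ).tsum_le_tsum (fun ι => (norm_FserTerm φ c ι x ξ).trans_le (hcU ι ξ))
        (hB.mul_right _))
  let S := ∑' ι, B ι
  have hS : 0 ≤ S := tsum_nonneg hB0
  let G : (Fin d → ℤ) → Euc d × Euc d → ℂ := fun ι q =>
    FserTerm e' φ a ι q.1 q.2 * conj (Fser e' φ c q.1 q.2)
  have hGc : ∀ ι, Continuous (G ι) := fun ι =>
    (continuous_FserTerm hΦ a ι).mul (Complex.continuous_conj.comp hVc)
  have hG : ∀ ι q, ‖G ι q‖ ≤ A ι * S * (W q.2 * U q.2) := fun ι q => by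
    rw [norm_mul, RCLike.norm_conj, norm_FserTerm]
    refine (mul_le_mul (haW ι q.2) (hV q.1 q.2) (norm_nonneg _)
      (mul_nonneg (hA0 ι) (hW0 _))).trans_eq ?_
    ring
  have hGK : ∀ ι q, ‖G ι q‖ ≤ A ι * S * K := fun ι q =>
    (hG ι q).trans (mul_le_mul_of_nonneg_left (hK _) (mul_nonneg (hA0 ι) hS))
  have hFG : ∀ q : Euc d × Euc d,
      ∑' ι, G ι q = Fser e' φ a q.1 q.2 * conj (Fser e' φ c q.1 q.2) := fun q => by
    rw [tsum_mul_right, tsum_FserTerm]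
  let μ : Measure (Euc d × Euc d) := (volume.restrict (paraSet e)).prod volume
  have hμ : (volume : Measure (Euc d × Euc d)).restrict (paraSet e ×ˢ Set.univ) = μ := by
    rw [Measure.volume_eq_prod, ← Measure.prod_restrict, Measure.restrict_univ]
  have hH : Integrable (fun q : Euc d × Euc d => W q.2 * U q.2) μ := hWU.comp_snd _
  have hGi : ∀ ι, Integrable (G ι) μ := fun ι =>
    (hH.const_mul (A ι * S)).mono' (hGc ι).aestronglyMeasurable
      (Eventually.of_forall (hG ι))
  have hGs : Summable fun ι => ∫ q, ‖G ι q‖ ∂μ := by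
    refine ((hA.mul_right S).mul_right (∫ q, W q.2 * U q.2 ∂μ)).of_nonneg_of_le
      (fun ι => integral_nonneg fun _ => norm_nonneg _) fun ι => ?_
    rw [← integral_const_mul]
    exact integral_mono (hGi ι).norm (hH.const_mul _) (hG ι)
  have h_int : Integrable
      (fun q : Euc d × Euc d => Fser e' φ a q.1 q.2 * conj (Fser e' φ c q.1 q.2)) μ := by
    simp only [← hFG]
    refine (hH.const_mul ((∑' ι, A ι) * S)).mono'
      (continuous_tsum hGc ((hA.mul_right S).mul_right K) hGK).aestronglyMeasurable
      (Eventually.of_forall fun q => ?_)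
    have hs := (hA.mul_right S).mul_right (W q.2 * U q.2)
    have hn := hs.of_nonneg_of_le (fun ι => norm_nonneg (G ι q)) fun ι => hG ι q
    refine (norm_tsum_le_tsum_norm hn).trans ((hn.tsum_le_tsum (fun ι => hG ι q) hs).trans_eq ?_)
    rw [tsum_mul_right, tsum_mul_right]
  refine ⟨by rw [IntegrableOn, hμ]; exact h_int, ?_⟩
  rw [integral_integral (f := fun x ξ => Fser e' φ a x ξ * conj (Fser e' φ c x ξ)) h_int]
  have h := hasSum_integral_of_summable_integral_norm hGi hGs
  simp only [hFG] at h
  have hterm : ∀ ι, ∫ q, G ι q ∂μ =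
      ((∫ ξ, ‖FT φ ξ‖ ^ 2) * (volume (paraSet e)).toReal : ℝ) * (a ι * conj (c ι)) := fun ι => by
    rw [integral_prod_symm _ (hGi ι)]
    have hinner : ∀ ξ, ∫ x in paraSet e, G ι (x, ξ) = _ := fun ξ =>
      integral_FserTerm_mul_conj_Fser he hdual ι ξ
        ((hB.mul_right (U ξ)).of_nonneg_of_le (fun _ => norm_nonneg _) fun κ => hcU κ ξ)
    simp only [hinner]
    rw [integral_const_mul, integral_complex_ofReal,
      integral_sub_left_eq_self (fun ξ => ‖FT φ ξ‖ ^ 2)]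
    push_cast
    ring
  rw [← h.tsum_eq, ← tsum_mul_left]
  exact tsum_congr hterm

end ParsevalSTFT

open ParsevalSTFT

/-- an extension of Parseval's identity: for suitable `a`, `φ` and a smooth
periodic `ψ`, the product `F(x,ξ) conj(V_φψ(x,ξ))` is integrable on `E × ℝ^d` and
`Σ_α a(α) conj(c(ψ,α)) = (‖φ‖²_{L²} |E|)⁻¹ ∫_E ∫_{ℝ^d} F(x,ξ) conj(V_φψ(x,ξ)) dξ dx`. -/
theorem parseval_stft_periodic
    {d : ℕ} (hd : 1 ≤ d) (s t : ℝ) (hs : 0 < s) (ht : 0 < t) (hst : 1 ≤ s + t)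
    (e e' : Fin d → Euc d) (he : LinearIndependent ℝ e)
    (hdual : ∀ j k, ⟪e j, e' k⟫_ℝ = if j = k then 2 * Real.pi else 0)
    (φ : Euc d → ℂ) (hφc : Continuous φ) (hφne : φ ≠ 0)
    (C₀ r₀ : ℝ) (hC₀ : 0 < C₀) (hr₀ : 0 < r₀)
    (hφ : ∀ x : Euc d, ‖φ x‖ ≤ C₀ * Real.exp (-r₀ * ‖x‖ ^ (1/t)))
    (hφF : ∀ ξ : Euc d, ‖FT φ ξ‖ ≤ C₀ * Real.exp (-r₀ * ‖ξ‖ ^ (1/s)))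
    (a : (Fin d → ℤ) → ℂ)
    (ha : ∀ ε : ℝ, 0 < ε → ∃ Cε : ℝ, 0 < Cε ∧ ∀ ι : Fin d → ℤ,
      ‖a ι‖ ≤ Cε * Real.exp (ε * ‖latPt e' ι‖ ^ (1/s)))
    (ψ : Euc d → ℂ) (hψ : ContDiff ℝ (⊤ : ℕ∞) ψ)
    (hψper : ∀ (x : Euc d) (j : Fin d → ℤ), ψ (x + latPt e j) = ψ x)
    (C₁ r₁ : ℝ) (hC₁ : 0 < C₁) (hr₁ : 0 < r₁)
    (hψc : ∀ ι : Fin d → ℤ,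
      ‖fourCoeff e ψ (latPt e' ι)‖ ≤ C₁ * Real.exp (-r₁ * ‖latPt e' ι‖ ^ (1/s))) :
    (∀ x ξ : Euc d, Summable fun ι : Fin d → ℤ =>
        ‖a ι * (starRingEnd ℂ) (FT φ (latPt e' ι - ξ)) *
            Complex.exp (Complex.I * (⟪x, latPt e' ι⟫_ℝ : ℂ))‖) ∧
    MeasureTheory.IntegrableOn
      (fun p : Euc d × Euc d => Fser e' φ a p.1 p.2 * (starRingEnd ℂ) (STFT φ ψ p.1 p.2))
      (paraSet e ×ˢ (Set.univ : Set (Euc d))) ∧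
    Summable (fun ι : Fin d → ℤ =>
      ‖a ι * (starRingEnd ℂ) (fourCoeff e ψ (latPt e' ι))‖) ∧
    ∑' ι : Fin d → ℤ, a ι * (starRingEnd ℂ) (fourCoeff e ψ (latPt e' ι)) =
      ((((∫ y : Euc d, ‖φ y‖ ^ 2) * (volume (paraSet e)).toReal : ℝ)) : ℂ)⁻¹ *
        ∫ x in paraSet e, ∫ ξ : Euc d,
          Fser e' φ a x ξ * (starRingEnd ℂ) (STFT φ ψ x ξ) := by
  have hp : 0 < 1 / s := by positivity
  have hφi : Integrable φ :=
    ((integrable_exp_neg_rpow hr₀ (by positivity : 0 < 1 / t)).const_mul C₀).mono'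
      hφc.aestronglyMeasurable (Eventually.of_forall hφ)
  have hΦc : Continuous (FT φ) := continuous_FT hφi
  have hΦi : Integrable (FT φ) :=
    ((integrable_exp_neg_rpow hr₀ hp).const_mul C₀).mono'
      hΦc.aestronglyMeasurable (Eventually.of_forall hφF)
  have he' : LinearIndependent ℝ e' := linearIndependent_dual hdual
  have hexp : ∀ {C ε : ℝ}, 0 < ε →
      Summable fun ι => C * Real.exp (-ε * ‖latPt e' ι‖ ^ (1 / s)) := fun hε =>
    (summable_exp_neg_latPt he' hε hp).mul_left _
  set c : (Fin d → ℤ) → ℂ := fun ι => fourCoeff e ψ (latPt e' ι)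
  have hcsum : Summable fun ι => ‖c ι‖ :=
    (hexp hr₁).of_nonneg_of_le (fun _ => norm_nonneg _) hψc
  have hV : ∀ x ξ, STFT φ ψ x ξ = Fser e' φ c x ξ :=
    STFT_eq_Fser hφi hcsum (hasSum_fourCoeff he hdual hψ.continuous hψper hcsum.of_norm)
  obtain ⟨C₂, ε₂, δ, hC₂, hε₂, hδ, hcU⟩ := exists_bound_of_exponential hp hr₀ hC₀ hr₁ hC₁ hψc hφF
  obtain ⟨C₃, ε₃, hC₃, hε₃, haW⟩ :=
    exists_bound_of_subexponential hp hr₀ hC₀ (half_pos hδ) ha hφF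
  have hWU : ∀ ξ : Euc d, Real.exp (δ / 2 * ‖ξ‖ ^ (1 / s)) * Real.exp (-δ * ‖ξ‖ ^ (1 / s)) =
      Real.exp (-(δ / 2) * ‖ξ‖ ^ (1 / s)) := fun ξ => by
    rw [← Real.exp_add]; ring_nf
  have hle : ∀ {r : ℝ}, 0 < r → ∀ ξ : Euc d, Real.exp (-r * ‖ξ‖ ^ (1 / s)) ≤ 1 := fun hr ξ =>
    Real.exp_le_one_iff.2 (by rw [neg_mul, neg_nonpos]; positivity)
  obtain ⟨h_int, heq⟩ := parseval_Fser he hdual hΦc (hexp hε₃) (hexp hε₂)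
    (fun ι => by positivity) (fun ι => by positivity) (fun ξ => (Real.exp_pos _).le) haW hcU
    (hle hδ) (by simpa only [hWU] using integrable_exp_neg_rpow (half_pos hδ) hp)
    (K := 1) (fun ξ => (hWU ξ).trans_le (hle (half_pos hδ) ξ))
  simp only [hV]
  refine ⟨fun x ξ => ?_, h_int, ?_, ?_⟩
  · refine ((hexp (C := C₃) hε₃).mul_right (Real.exp (δ / 2 * ‖ξ‖ ^ (1 / s)))).of_nonneg_of_le
      (fun _ => norm_nonneg _) fun ι => ?_
    rw [norm_mul, norm_exp_I_mul, mul_one]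
    exact haW ι ξ
  · obtain ⟨C, hC, haC⟩ := ha (r₁ / 2) (half_pos hr₁)
    refine (hexp (C := C * C₁) (half_pos hr₁)).of_nonneg_of_le (fun _ => norm_nonneg _) fun ι => ?_
    rw [norm_mul, RCLike.norm_conj]
    refine (mul_le_mul (haC ι) (hψc ι) (norm_nonneg _) (by positivity)).trans_eq ?_
    rw [mul_mul_mul_comm, ← Real.exp_add]
    ring_nf
  · have hpos : 0 < ∫ y, ‖φ y‖ ^ 2 := by
      obtain ⟨y, hy⟩ := Function.ne_iff.1 hφne
      have hcont : Continuous fun y => ‖φ y‖ ^ 2 := by fun_prop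
      have hsq : Integrable fun y => ‖φ y‖ ^ 2 := by
        refine (hφi.norm.const_mul C₀).mono' hcont.aestronglyMeasurable
          (Eventually.of_forall fun y => ?_)
        rw [Real.norm_of_nonneg (by positivity), pow_two]
        refine mul_le_mul_of_nonneg_right ((hφ y).trans ?_) (norm_nonneg _)
        refine mul_le_of_le_one_right hC₀.le (Real.exp_le_one_iff.2 ?_)
        rw [neg_mul, neg_nonpos]
        positivity
      exact integral_pos_of_integrable_nonneg_nonzero (x := y) hcont hsq
        (fun y => by positivity) (by simpa using hy)
    rw [heq, integral_norm_sq_FT hφc hφi hΦi, inv_mul_cancel_left₀]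
    exact Complex.ofReal_ne_zero.2 (mul_ne_zero hpos.ne' (volume_paraSet_ne_zero he))

end
end

section
/- Let d ≥ 1, s, t > 0 with s + t ≥ 1, E ⊆ ℝ^d be a non-degenerate parallelepiped, and let φ : ℝ^d → ℂ be a nonzero continuous function with |φ(x)| ≤ C₀ e^{-r₀|x|^{1/t}} and |φ̂(ξ)| ≤ C₀ e^{-r₀|ξ|^{1/s}} for some C₀, r₀ > 0. Let a : Λ'_E → ℂ satisfy: for every ε > 0 there is C_ε > 0 with |a(α)| ≤ C_ε e^{ε|α|^{1/s}} for all α, and define F(x,ξ) = e^{-i⟨x,ξ⟩} Σ_{β∈Λ'_E} a(β) conj(φ̂(β−ξ)) e^{i⟨x,β⟩} (absolutely convergent for every (x,ξ)). Then for every α ∈ Λ'_E the integrand below is absolutely integrable on E × ℝ^d and a(α) = (‖φ‖²_{L²(ℝ^d)} |E|)^{-1} ∫_E ( ∫_{ℝ^d} F(x,ξ) φ̂(α−ξ) e^{-i⟨x,α−ξ⟩} dξ ) dx. -/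
open MeasureTheory Filter
open scoped BigOperators InnerProductSpace Topology

noncomputable section

lemma integrable_tsum_of_norm_le_mul {X ι : Type*} [MeasurableSpace X] [Countable ι]
    {μ : Measure X} {F : ι → X → ℂ} {u : ι → ℝ} {G : X → ℝ}
    (hF : ∀ i, AEStronglyMeasurable (F i) μ) (hu : Summable u) (hG : Integrable G μ)
    (h : ∀ i x, ‖F i x‖ ≤ u i * G x) :
    Integrable (fun x => ∑' i, F i x) μ ∧
      HasSum (fun i => ∫ x, F i x ∂μ) (∫ x, ∑' i, F i x ∂μ) := by
  have hFi : ∀ i, Integrable (F i) μ := fun i =>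
    (hG.const_mul (u i)).mono' (hF i) (.of_forall (h i))
  have hs : ∀ x, HasSum (fun i => u i * G x) ((∑' i, u i) * G x) := fun x =>
    hu.hasSum.mul_right _
  have hsum : ∀ x, Summable fun i => F i x := fun x =>
    .of_norm_bounded (hs x).summable fun i => h i x
  refine ⟨(hG.const_mul (∑' i, u i)).mono' ?_ (.of_forall fun x => ?_), ?_⟩
  · exact aestronglyMeasurable_of_tendsto_ae (u := atTop) (f := fun (s : Finset ι) x => ∑ i ∈ s, F i x)
      (fun s => Finset.aestronglyMeasurable_fun_sum s fun i _ => hF i)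
      (.of_forall fun x => (hsum x).hasSum)
  · exact tsum_of_norm_bounded (hs x) fun i => h i x
  · refine hasSum_integral_of_summable_integral_norm hFi ?_
    refine .of_nonneg_of_le (fun i => by positivity) (fun i => ?_) (hu.mul_right (∫ x, G x ∂μ))
    rw [← integral_const_mul]
    exact integral_mono (hFi i).norm (hG.const_mul _) (h i)

lemma norm_add_rpow_le {V : Type*} [SeminormedAddCommGroup V] {p : ℝ} (hp : 0 ≤ p) (u v : V) :
    ‖u + v‖ ^ p ≤ 2 ^ p * (‖u‖ ^ p + ‖v‖ ^ p) := by
  wlog h : ‖u‖ ≤ ‖v‖ generalizing u v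
  · rw [add_comm u, add_comm (_ ^ p)]
    exact this v u (not_le.1 h).le
  calc ‖u + v‖ ^ p ≤ (2 * ‖v‖) ^ p := by
        gcongr
        linarith [norm_add_le u v]
    _ = 2 ^ p * ‖v‖ ^ p := Real.mul_rpow (by norm_num) (norm_nonneg _)
    _ ≤ _ := by
        gcongr
        simpa using Real.rpow_nonneg (norm_nonneg u) p

lemma integrable_exp_neg_mul_norm_rpow {d : ℕ} (hd : 1 ≤ d) {c p : ℝ} (hc : 0 < c) (hp : 0 < p) :
    Integrable fun x : Euc d => Real.exp (-c * ‖x‖ ^ p) := by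
  have : Nonempty (Fin d) := ⟨⟨0, hd⟩⟩
  refine (integrable_fun_norm_addHaar (volume : Measure (Euc d))
    (f := fun y => Real.exp (-c * y ^ p))).2 ?_
  refine (integrableOn_rpow_mul_exp_neg_mul_rpow (s := ((d - 1 : ℕ) : ℝ)) ?_ hp hc).congr_fun
    (fun y _ => ?_) measurableSet_Ioi
  · linarith [(Nat.cast_nonneg (d - 1) : (0 : ℝ) ≤ _)]
  · simp

lemma exp_neg_mul_rpow_le {c p y : ℝ} (hc : 0 < c) (hy : 0 < y) (n : ℕ) :
    Real.exp (-c * y ^ p) ≤ n.factorial / c ^ n * y ^ (-(p * n)) := by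
  have hz : 0 < c * y ^ p := by positivity
  have h := Real.pow_div_factorial_le_exp _ hz.le n
  rw [neg_mul, Real.exp_neg, Real.rpow_neg hy.le, Real.rpow_mul_natCast hy.le]
  rw [inv_le_comm₀ (Real.exp_pos _) (by positivity)]
  refine le_of_eq_of_le ?_ h
  rw [mul_pow]
  field_simp

lemma linearIndependent_of_dual {d : ℕ} {e e' : Fin d → Euc d}
    (hdual : ∀ j k, ⟪e j, e' k⟫_ℝ = if j = k then 2 * Real.pi else 0) :
    LinearIndependent ℝ e' := by
  rw [Fintype.linearIndependent_iff]
  intro g hg j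
  have := congrArg (fun v => ⟪e j, v⟫_ℝ) hg
  simpa [inner_sum, inner_smul_right, hdual, Real.pi_ne_zero] using this

lemma latPt_injective {d : ℕ} {e : Fin d → Euc d} (he : LinearIndependent ℝ e) :
    Function.Injective (latPt e) := by
  intro m n h
  have := Fintype.linearIndependent_iff.1 he (fun i => (m i : ℝ) - n i)
    (by simpa [latPt, sub_smul, sub_eq_zero] using h)
  funext i
  exact_mod_cast sub_eq_zero.1 (this i)

lemma latPt_sub {d : ℕ} (e : Fin d → Euc d) (m n : Fin d → ℤ) :
    latPt e (m - n) = latPt e m - latPt e n := by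
  simp [latPt, sub_smul]

lemma summable_exp_neg_norm_latPt_rpow {d : ℕ} {e : Fin d → Euc d}
    (he : LinearIndependent ℝ e) {c p : ℝ} (hc : 0 < c) (hp : 0 < p) :
    Summable fun j : Fin d → ℤ => Real.exp (-c * ‖latPt e j‖ ^ p) := by
  let b := basisOfLinearIndependentOfCardEqFinrank' e he (by simp)
  have hb : ⇑b = e := coe_basisOfLinearIndependentOfCardEqFinrank' ..
  let L := Submodule.span ℤ (Set.range b)
  have hmem : ∀ j, latPt e j ∈ L := fun j => by
    refine Submodule.sum_mem _ fun i _ => ?_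
    rw [Int.cast_smul_eq_zsmul]
    exact Submodule.smul_mem _ _ (Submodule.subset_span ⟨i, congrFun hb i⟩)
  obtain ⟨n, hn⟩ := exists_nat_gt ((Module.finrank ℤ L : ℝ) / p)
  have hs := (ZLattice.summable_norm_rpow L (-(p * n)) (by
    rw [div_lt_iff₀ hp] at hn; linarith)).comp_injective
      (i := fun j => (⟨latPt e j, hmem j⟩ : L))
      fun m k h => latPt_injective he (congrArg Subtype.val h)
  refine .of_norm_bounded_eventually (hs.mul_left (n.factorial / c ^ n)) ?_
  refine (Set.finite_singleton (0 : Fin d → ℤ)).subset fun j hj => ?_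
  by_contra h0
  refine hj ?_
  change ‖Real.exp _‖ ≤ _
  rw [Real.norm_of_nonneg (Real.exp_pos _).le]
  refine exp_neg_mul_rpow_le hc (norm_pos_iff.2 fun h => h0 ?_) n
  exact latPt_injective he (by simpa [latPt] using h)

lemma FT_eq_fourier {d : ℕ} (φ : Euc d → ℂ) (ξ : Euc d) :
    FT φ ξ = (((2 * Real.pi) ^ (-(d:ℝ)/2) : ℝ) : ℂ) *
      FourierTransform.fourier φ ((2 * Real.pi)⁻¹ • ξ) := by
  rw [FT, Real.fourier_eq']
  congr 2
  funext x
  rw [smul_eq_mul, mul_comm, inner_smul_right]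
  congr 2
  push_cast
  field_simp [Real.pi_ne_zero]

lemma continuous_fourier_of_integrable {d : ℕ} {φ : Euc d → ℂ} (hφ : Integrable φ) :
    Continuous (FourierTransform.fourier φ) :=
  VectorFourier.fourierIntegral_continuous Real.continuous_fourierChar continuous_inner hφ

lemma continuous_FT {d : ℕ} {φ : Euc d → ℂ} (hφ : Integrable φ) : Continuous (FT φ) := by
  have := continuous_fourier_of_integrable hφ
  simp only [funext (FT_eq_fourier φ)]
  fun_prop

lemma integral_norm_sq_fourier_of_integrable {d : ℕ} {φ : Euc d → ℂ} (hc : Continuous φ)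
    (hi : Integrable φ) (hF : Integrable (FourierTransform.fourier φ)) :
    ∫ ξ, ‖FourierTransform.fourier φ ξ‖ ^ 2 = ∫ x, ‖φ x‖ ^ 2 := by
  have h := VectorFourier.integral_sesq_fourierIntegral_eq_neg_flip (μ := volume) (ν := volume)
    (innerSL ℂ) Real.continuous_fourierChar (L := innerₗ (Euc d)) continuous_inner hi hF
  have hinv : ∀ x, VectorFourier.fourierIntegral Real.fourierChar volume (-(innerₗ (Euc d)).flip)
      (FourierTransform.fourier φ) x = φ x := fun x => by
    rw [← congrFun (hc.fourierInv_fourier_eq hi hF) x, Real.fourierInv_eq]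
    simp [VectorFourier.fourierIntegral, real_inner_comm]
  simp only [hinv] at h
  have hn : ∀ z : ℂ, innerSL ℂ z z = ((‖z‖ ^ 2 : ℝ) : ℂ) := fun z => by
    simp
  have h' : ∫ ξ, ((‖FourierTransform.fourier φ ξ‖ ^ 2 : ℝ) : ℂ) = ∫ x, ((‖φ x‖ ^ 2 : ℝ) : ℂ) := by
    simp only [← hn]
    exact h
  rw [integral_complex_ofReal, integral_complex_ofReal] at h'
  exact_mod_cast h'

lemma integral_norm_sq_FT {d : ℕ} {φ : Euc d → ℂ} (hc : Continuous φ) (hi : Integrable φ)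
    (hF : Integrable (FT φ)) : ∫ ξ, ‖FT φ ξ‖ ^ 2 = ∫ x, ‖φ x‖ ^ 2 := by
  have hpi : (0 : ℝ) < 2 * Real.pi := by positivity
  have hFi : Integrable (FourierTransform.fourier φ) := by
    simp only [funext (FT_eq_fourier φ)] at hF
    rw [integrable_const_mul_iff 
      (by simp [(Real.rpow_pos_of_pos hpi _).ne'])] at hF
    exact (integrable_comp_smul_iff volume _ (inv_ne_zero hpi.ne')).1 hF
  rw [← integral_norm_sq_fourier_of_integrable hc hi hFi]
  have h := Measure.integral_comp_smul (volume : Measure (Euc d))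
    (fun ξ => ‖FourierTransform.fourier φ ξ‖ ^ 2) (2 * Real.pi)⁻¹
  simp only [FT_eq_fourier, norm_mul, mul_pow, integral_const_mul, h, finrank_euclideanSpace_fin,
    smul_eq_mul, ← mul_assoc, Complex.norm_real]
  convert one_mul _
  rw [Real.norm_of_nonneg (by positivity), ← Real.rpow_mul_natCast hpi.le, inv_pow, inv_inv,
    abs_of_pos (by positivity), ← Real.rpow_natCast (2 * Real.pi) d, ← Real.rpow_add hpi]
  simp

lemma setIntegral_Icc_exp_two_pi (n : ℤ) :
    ∫ t in Set.Icc (0 : ℝ) 1, Complex.exp (Complex.I * (2 * Real.pi * n * t : ℝ)) =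
      if n = 0 then 1 else 0 := by
  split_ifs with h
  · simp [h]
  · have hc : Complex.I * (2 * Real.pi * n) ≠ 0 := by simp [h, Real.pi_ne_zero]
    rw [integral_Icc_eq_integral_Ioc, ← intervalIntegral.integral_of_le zero_le_one]
    have := integral_exp_mul_complex (a := 0) (b := 1) hc
    push_cast
    simp only [← mul_assoc] at this ⊢
    rw [this]
    have h1 : Complex.exp (Complex.I * 2 * Real.pi * n) = 1 := by
      rw [← Complex.exp_int_mul_two_pi_mul_I n]
      ring_nf
    simp [h1]

/-- The linear map sending the standard basis of `ℝ^d` to the family `e`. -/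
def paraMap {d : ℕ} (e : Fin d → Euc d) : Euc d →L[ℝ] Euc d :=
  LinearMap.toContinuousLinearMap
    (Fintype.linearCombination ℝ e ∘ₗ (WithLp.linearEquiv 2 ℝ (Fin d → ℝ)).toLinearMap)

lemma paraMap_apply {d : ℕ} (e : Fin d → Euc d) (x : Euc d) : paraMap e x = ∑ i, x i • e i := rfl

lemma paraMap_injective {d : ℕ} {e : Fin d → Euc d} (he : LinearIndependent ℝ e) :
    Function.Injective (paraMap e) := by
  refine (injective_iff_map_eq_zero _).2 fun x hx => ?_
  ext i
  exact Fintype.linearIndependent_iff.1 he (fun i => x i) hx i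

lemma paraSet_eq_image {d : ℕ} (e : Fin d → Euc d) :
    paraSet e = paraMap e '' (WithLp.ofLp ⁻¹' (Set.univ.pi fun _ => Set.Icc (0 : ℝ) 1)) := by
  ext x
  constructor
  · rintro ⟨t, ht, rfl⟩
    exact ⟨WithLp.toLp 2 t, ht, rfl⟩
  · rintro ⟨t, ht, rfl⟩
    exact ⟨t, ht, rfl⟩

lemma isCompact_paraSet {d : ℕ} (e : Fin d → Euc d) : IsCompact (paraSet e) :=
  (isCompact_univ_pi fun _ => isCompact_Icc).image (by fun_prop)

lemma inner_paraMap_latPt {d : ℕ} {e e' : Fin d → Euc d}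
    (hdual : ∀ j k, ⟪e j, e' k⟫_ℝ = if j = k then 2 * Real.pi else 0) (x : Euc d)
    (n : Fin d → ℤ) : ⟪paraMap e x, latPt e' n⟫_ℝ = ∑ i, 2 * Real.pi * n i * x i := by
  simp only [paraMap_apply, latPt, sum_inner, inner_sum, inner_smul_left, inner_smul_right, hdual]
  refine Finset.sum_congr rfl fun i _ => ?_
  simp
  ring

lemma setIntegral_paraSet_exp_eq_det {d : ℕ} {e e' : Fin d → Euc d} (he : LinearIndependent ℝ e)
    (hdual : ∀ j k, ⟪e j, e' k⟫_ℝ = if j = k then 2 * Real.pi else 0) (n : Fin d → ℤ) :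
    ∫ x in paraSet e, Complex.exp (Complex.I * (⟪x, latPt e' n⟫_ℝ : ℂ)) =
      if n = 0 then ((|(paraMap e).det| : ℝ) : ℂ) else 0 := by
  have hm : MeasurableSet (Set.univ.pi fun _ : Fin d => Set.Icc (0 : ℝ) 1) :=
    .univ_pi fun _ => measurableSet_Icc
  have hmp := EuclideanSpace.volume_preserving_symm_measurableEquiv_toLp (Fin d)
  have hmb : MeasurableSet
      (WithLp.ofLp (p := 2) ⁻¹' (Set.univ.pi fun _ : Fin d => Set.Icc (0 : ℝ) 1)) :=
    hmp.measurable hm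
  rw [paraSet_eq_image, integral_image_eq_integral_abs_det_fderiv_smul volume
    hmb (fun x _ => (paraMap e).hasFDerivWithinAt)
    (paraMap_injective he).injOn, integral_smul]
  have h1 := hmp.setIntegral_preimage_emb (MeasurableEquiv.measurableEmbedding _)
    (fun t : Fin d → ℝ => ∏ i, Complex.exp (Complex.I * (2 * Real.pi * n i * t i : ℝ)))
    (Set.univ.pi fun _ : Fin d => Set.Icc (0 : ℝ) 1)
  rw [volume_pi, Measure.restrict_pi_pi, integral_fintype_prod_eq_prod (𝕜 := ℂ)
    (fun i (t : ℝ) => Complex.exp (Complex.I * (2 * Real.pi * n i * t : ℝ)))] at h1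
  simp only [setIntegral_Icc_exp_two_pi] at h1
  simp only [inner_paraMap_latPt hdual, Complex.ofReal_sum, Finset.mul_sum, Complex.exp_sum]
  refine (congrArg _ h1).trans ?_
  by_cases hn : n = 0
  · simp [hn]
  · obtain ⟨i, hi⟩ := Function.ne_iff.1 hn
    rw [Finset.prod_eq_zero (Finset.mem_univ i) (if_neg hi), if_neg hn, smul_zero]

lemma volume_paraSet_toReal {d : ℕ} {e e' : Fin d → Euc d} (he : LinearIndependent ℝ e)
    (hdual : ∀ j k, ⟪e j, e' k⟫_ℝ = if j = k then 2 * Real.pi else 0) :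
    (volume (paraSet e)).toReal = |(paraMap e).det| := by
  have h := setIntegral_paraSet_exp_eq_det he hdual 0
  simpa [latPt, Measure.real, ← Complex.ofReal_inj] using h

lemma setIntegral_paraSet_exp {d : ℕ} {e e' : Fin d → Euc d} (he : LinearIndependent ℝ e)
    (hdual : ∀ j k, ⟪e j, e' k⟫_ℝ = if j = k then 2 * Real.pi else 0) (n : Fin d → ℤ) :
    ∫ x in paraSet e, Complex.exp (Complex.I * (⟪x, latPt e' n⟫_ℝ : ℂ)) =
      if n = 0 then ((volume (paraSet e)).toReal : ℂ) else 0 := by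
  rw [setIntegral_paraSet_exp_eq_det he hdual, volume_paraSet_toReal he hdual]

lemma volume_paraSet_pos {d : ℕ} {e e' : Fin d → Euc d} (he : LinearIndependent ℝ e)
    (hdual : ∀ j k, ⟪e j, e' k⟫_ℝ = if j = k then 2 * Real.pi else 0) :
    0 < (volume (paraSet e)).toReal := by
  rw [volume_paraSet_toReal he hdual, abs_pos]
  exact (LinearEquiv.ofInjectiveEndo _ (paraMap_injective he)).isUnit_det'.ne_zero

lemma exists_norm_coeff_mul_le {d : ℕ} {e' : Fin d → Euc d} {w : Euc d → ℂ}
    {a : (Fin d → ℤ) → ℂ} {C₀ r₀ p η : ℝ} (hp : 0 ≤ p) (hC₀ : 0 < C₀) (hr₀ : 0 < r₀) (hη : 0 < η)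
    (hw : ∀ ξ, ‖w ξ‖ ≤ C₀ * Real.exp (-r₀ * ‖ξ‖ ^ p))
    (ha : ∀ ε : ℝ, 0 < ε → ∃ Cε : ℝ, 0 < Cε ∧ ∀ ι : Fin d → ℤ,
      ‖a ι‖ ≤ Cε * Real.exp (ε * ‖latPt e' ι‖ ^ p)) :
    ∃ C δ : ℝ, 0 < C ∧ 0 < δ ∧ ∀ ι ξ, ‖a ι‖ * ‖w (latPt e' ι - ξ)‖ ≤
      C * Real.exp (-δ * ‖latPt e' ι‖ ^ p) * Real.exp (η * ‖ξ‖ ^ p) := by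
  set m := min η r₀
  have hm : 0 < m := lt_min hη hr₀
  obtain ⟨C, hC, hCa⟩ := ha (m / (2 * 2 ^ p)) (by positivity)
  refine ⟨C * C₀, m / (2 * 2 ^ p), by positivity, by positivity, fun ι ξ => ?_⟩
  calc ‖a ι‖ * ‖w (latPt e' ι - ξ)‖
      ≤ (C * Real.exp (m / (2 * 2 ^ p) * ‖latPt e' ι‖ ^ p)) *
          (C₀ * Real.exp (-r₀ * ‖latPt e' ι - ξ‖ ^ p)) := by
        gcongr
        · exact hCa ι
        · exact hw _
    _ = C * C₀ * Real.exp (m / (2 * 2 ^ p) * ‖latPt e' ι‖ ^ p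
          + -r₀ * ‖latPt e' ι - ξ‖ ^ p) := by
        rw [Real.exp_add]
        ring
    _ ≤ C * C₀ * Real.exp (-(m / (2 * 2 ^ p)) * ‖latPt e' ι‖ ^ p + η * ‖ξ‖ ^ p) := by
        gcongr C * C₀ * Real.exp ?_
        have h := norm_add_rpow_le hp (latPt e' ι - ξ) ξ
        rw [sub_add_cancel] at h
        have h1 := mul_le_mul_of_nonneg_left h (show 0 ≤ m / 2 ^ p by positivity)
        rw [← mul_assoc, div_mul_cancel₀ _ (by positivity)] at h1
        have h2 := mul_le_mul_of_nonneg_right (min_le_left η r₀)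
          (Real.rpow_nonneg (norm_nonneg ξ) p)
        have h3 := mul_le_mul_of_nonneg_right (min_le_right η r₀)
          (Real.rpow_nonneg (norm_nonneg (latPt e' ι - ξ)) p)
        have h4 : m / 2 ^ p = 2 * (m / (2 * 2 ^ p)) := by field_simp
        rw [h4] at h1
        linarith
    _ = _ := by
        rw [Real.exp_add, ← mul_assoc]

lemma exp_mul_norm_rpow_mul_exp_le {V : Type*} [NormedAddCommGroup V] {p r : ℝ} (hp : 0 ≤ p)
    (hr : 0 < r) (v ξ : V) :
    Real.exp (r / (2 * 2 ^ p) * ‖ξ‖ ^ p) * Real.exp (-r * ‖v - ξ‖ ^ p) ≤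
      Real.exp (r / 2 * ‖v‖ ^ p) * Real.exp (-(r / 2) * ‖ξ - v‖ ^ p) := by
  rw [← Real.exp_add, ← Real.exp_add, Real.exp_le_exp, norm_sub_rev v]
  have h := norm_add_rpow_le hp (ξ - v) v
  rw [sub_add_cancel] at h
  have h1 := mul_le_mul_of_nonneg_left h (show 0 ≤ r / (2 * 2 ^ p) by positivity)
  rw [← mul_assoc, show r / (2 * 2 ^ p) * 2 ^ p = r / 2 by field_simp] at h1
  linarith

lemma norm_exp_I_mul_inner {d : ℕ} (x y : Euc d) :
    ‖Complex.exp (Complex.I * (⟪x, y⟫_ℝ : ℂ))‖ = 1 := by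
  rw [mul_comm, Complex.norm_exp_ofReal_mul_I]

lemma Fser_mul_eq_tsum {d : ℕ} (e' : Fin d → Euc d) (φ : Euc d → ℂ) (a : (Fin d → ℤ) → ℂ)
    (α : Fin d → ℤ) (x ξ : Euc d) :
    Fser e' φ a x ξ * FT φ (latPt e' α - ξ) *
        Complex.exp (-(Complex.I) * (⟪x, latPt e' α - ξ⟫_ℝ : ℂ)) =
      ∑' ι, Complex.exp (Complex.I * (⟪x, latPt e' (ι - α)⟫_ℝ : ℂ)) *
        (a ι * (starRingEnd ℂ) (FT φ (latPt e' ι - ξ)) * FT φ (latPt e' α - ξ)) := by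
  rw [Fser, mul_right_comm, mul_right_comm (Complex.exp _), ← Complex.exp_add, mul_assoc,
    mul_comm (tsum _), ← mul_assoc, ← tsum_mul_left]
  refine tsum_congr fun ι => ?_
  have h : Complex.exp (Complex.I * (⟪x, latPt e' (ι - α)⟫_ℝ : ℂ)) =
      Complex.exp (-Complex.I * (⟪x, ξ⟫_ℝ : ℂ) + -Complex.I * (⟪x, latPt e' α - ξ⟫_ℝ : ℂ)) *
        Complex.exp (Complex.I * (⟪x, latPt e' ι⟫_ℝ : ℂ)) := by
    rw [← Complex.exp_add, latPt_sub, inner_sub_right, inner_sub_right]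
    push_cast
    ring_nf
  rw [h]
  ring

/-- the Fourier coefficients can be recovered from the short-time Fourier
transform: `a(α) = (‖φ‖²_{L²} |E|)⁻¹ ∫_E ∫_{ℝ^d} F(x,ξ) φ̂(α−ξ) e^{-i⟨x,α−ξ⟩} dξ dx`,
the integrand being absolutely integrable on `E × ℝ^d`. -/
theorem fourier_coeff_from_stft
    {d : ℕ} (hd : 1 ≤ d) (s t : ℝ) (hs : 0 < s) (ht : 0 < t) (hst : 1 ≤ s + t)
    (e e' : Fin d → Euc d) (he : LinearIndependent ℝ e)
    (hdual : ∀ j k, ⟪e j, e' k⟫_ℝ = if j = k then 2 * Real.pi else 0)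
    (φ : Euc d → ℂ) (hφc : Continuous φ) (hφne : φ ≠ 0)
    (C₀ r₀ : ℝ) (hC₀ : 0 < C₀) (hr₀ : 0 < r₀)
    (hφ : ∀ x : Euc d, ‖φ x‖ ≤ C₀ * Real.exp (-r₀ * ‖x‖ ^ (1/t)))
    (hφF : ∀ ξ : Euc d, ‖FT φ ξ‖ ≤ C₀ * Real.exp (-r₀ * ‖ξ‖ ^ (1/s)))
    (a : (Fin d → ℤ) → ℂ)
    (ha : ∀ ε : ℝ, 0 < ε → ∃ Cε : ℝ, 0 < Cε ∧ ∀ ι : Fin d → ℤ,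
      ‖a ι‖ ≤ Cε * Real.exp (ε * ‖latPt e' ι‖ ^ (1/s))) :
    (∀ x ξ : Euc d, Summable fun ι : Fin d → ℤ =>
      ‖a ι * (starRingEnd ℂ) (FT φ (latPt e' ι - ξ)) *
          Complex.exp (Complex.I * (⟪x, latPt e' ι⟫_ℝ : ℂ))‖) ∧
    ∀ α : Fin d → ℤ,
      MeasureTheory.IntegrableOn
        (fun p : Euc d × Euc d =>
          Fser e' φ a p.1 p.2 * FT φ (latPt e' α - p.2) *
            Complex.exp (-(Complex.I) * (⟪p.1, latPt e' α - p.2⟫_ℝ : ℂ)))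
        (paraSet e ×ˢ (Set.univ : Set (Euc d))) ∧
      a α =
        ((((∫ y : Euc d, ‖φ y‖ ^ 2) * (volume (paraSet e)).toReal : ℝ)) : ℂ)⁻¹ *
          ∫ x in paraSet e, ∫ ξ : Euc d,
            Fser e' φ a x ξ * FT φ (latPt e' α - ξ) *
              Complex.exp (-(Complex.I) * (⟪x, latPt e' α - ξ⟫_ℝ : ℂ)) := by
  have hp : 0 < 1 / s := by positivity
  have hφi : Integrable φ :=
    ((integrable_exp_neg_mul_norm_rpow hd hr₀ (show 0 < 1 / t by positivity)).const_mul C₀).mono'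
      hφc.aestronglyMeasurable (.of_forall hφ)
  have hFc := continuous_FT hφi
  have hFi : Integrable (FT φ) :=
    ((integrable_exp_neg_mul_norm_rpow hd hr₀ hp).const_mul C₀).mono'
      hFc.aestronglyMeasurable (.of_forall hφF)
  obtain ⟨C, δ, hC, hδ, hb⟩ := exists_norm_coeff_mul_le (η := r₀ / (2 * 2 ^ (1 / s))) hp.le hC₀ hr₀
    (by positivity) hφF ha
  have hsum := summable_exp_neg_norm_latPt_rpow (linearIndependent_of_dual hdual) hδ hp
  refine ⟨fun x ξ => ?_, fun α => ?_⟩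
  · refine .of_nonneg_of_le (fun ι => norm_nonneg _) (fun ι => ?_)
      ((hsum.mul_left C).mul_right (Real.exp (r₀ / (2 * 2 ^ (1 / s)) * ‖ξ‖ ^ (1 / s))))
    rw [norm_mul, norm_mul, norm_exp_I_mul_inner, mul_one, RCLike.norm_conj]
    exact hb ι ξ
  simp only [Fser_mul_eq_tsum]
  set W : (Fin d → ℤ) → Euc d → ℂ := fun ι ξ =>
    a ι * (starRingEnd ℂ) (FT φ (latPt e' ι - ξ)) * FT φ (latPt e' α - ξ) with hW
  set G : Euc d → ℝ := fun ξ => Real.exp (-(r₀ / 2) * ‖ξ - latPt e' α‖ ^ (1 / s))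
  have hGi : Integrable G :=
    (integrable_exp_neg_mul_norm_rpow hd (half_pos hr₀) hp).comp_sub_right (latPt e' α)
  have hWc : ∀ ι, Continuous (W ι) := fun ι => by
    have := Complex.continuous_conj
    fun_prop
  set D := C₀ * Real.exp (r₀ / 2 * ‖latPt e' α‖ ^ (1 / s))
  have hWb : ∀ ι ξ, ‖W ι ξ‖ ≤ C * Real.exp (-δ * ‖latPt e' ι‖ ^ (1 / s)) * D * G ξ := fun ι ξ => by
    rw [hW, norm_mul, norm_mul, RCLike.norm_conj]
    refine (mul_le_mul (hb ι ξ) (hφF _) (norm_nonneg _) (by positivity)).trans ?_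
    have := mul_le_mul_of_nonneg_left (exp_mul_norm_rpow_mul_exp_le hp.le hr₀ (latPt e' α) ξ)
      (show 0 ≤ C * Real.exp (-δ * ‖latPt e' ι‖ ^ (1 / s)) * C₀ by positivity)
    refine (le_of_eq ?_).trans (this.trans (le_of_eq ?_)) <;> ring
  have hEfin : IsFiniteMeasure (volume.restrict (paraSet e)) :=
    isFiniteMeasure_restrict.2 (isCompact_paraSet e).measure_lt_top.ne
  have hμ : (volume : Measure (Euc d × Euc d)).restrict (paraSet e ×ˢ Set.univ) =
      (volume.restrict (paraSet e)).prod volume := by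
    rw [Measure.volume_eq_prod, ← Measure.prod_restrict, Measure.restrict_univ]
  obtain ⟨hI, hS⟩ := integrable_tsum_of_norm_le_mul
    (μ := (volume.restrict (paraSet e)).prod (volume : Measure (Euc d)))
    (F := fun ι q => Complex.exp (Complex.I * (⟪q.1, latPt e' (ι - α)⟫_ℝ : ℂ)) * W ι q.2)
    (fun ι => by
      have := hWc ι
      exact Continuous.aestronglyMeasurable (by fun_prop))
    ((hsum.mul_left C).mul_right D) (hGi.comp_snd _) fun ι q => by
      rw [norm_mul, norm_exp_I_mul_inner, one_mul]
      exact hWb ι q.2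
  refine ⟨by rwa [IntegrableOn, hμ], ?_⟩
  rw [← integral_prod _ hI, ← hS.tsum_eq, tsum_eq_single α]
  · rw [integral_prod_mul (fun x => Complex.exp (Complex.I * (⟪x, latPt e' (α - α)⟫_ℝ : ℂ))) (W α),
      setIntegral_paraSet_exp he hdual, if_pos (sub_self α)]
    have hWα : ∫ ξ, W α ξ = a α * ((∫ y, ‖φ y‖ ^ 2 : ℝ) : ℂ) := by
      rw [← integral_norm_sq_FT hφc hφi hFi,
        ← integral_sub_left_eq_self (fun ξ => ‖FT φ ξ‖ ^ 2) volume (latPt e' α),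
        ← integral_complex_ofReal, ← integral_const_mul]
      refine integral_congr_ae (.of_forall fun ξ => ?_)
      simp only [hW, mul_assoc, Complex.conj_mul', Complex.ofReal_pow]
    have hvol : ((volume (paraSet e)).toReal : ℂ) ≠ 0 :=
      Complex.ofReal_ne_zero.2 (volume_paraSet_pos he hdual).ne'
    have hL2 : ((∫ y, ‖φ y‖ ^ 2 : ℝ) : ℂ) ≠ 0 := by
      obtain ⟨x, hx⟩ := Function.ne_iff.1 hφne
      refine Complex.ofReal_ne_zero.2 (ne_of_gt ?_)
      have hi2 : Integrable fun y => ‖φ y‖ ^ 2 :=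
        (hφi.norm.const_mul C₀).mono' (by fun_prop) (.of_forall fun y => by
          have h1 : ‖φ y‖ ≤ C₀ := (hφ y).trans (mul_le_of_le_one_right hC₀.le
            (Real.exp_le_one_iff.2 (mul_nonpos_of_nonpos_of_nonneg (by linarith) (by positivity))))
          rw [Real.norm_of_nonneg (by positivity), sq]
          gcongr)
      refine (integral_pos_iff_support_of_nonneg (fun y => by positivity) hi2).2 ?_
      refine IsOpen.measure_pos _ (Continuous.isOpen_support (by fun_prop)) ⟨x, ?_⟩
      simpa using hx
    rw [hWα, Complex.ofReal_mul]
    field_simp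
  · intro ι hι
    rw [integral_prod_mul (fun x => Complex.exp (Complex.I * (⟪x, latPt e' (ι - α)⟫_ℝ : ℂ))) (W ι),
      setIntegral_paraSet_exp he hdual, if_neg (sub_ne_zero.2 hι), zero_mul]

end
end

section
/- Let d ≥ 1, E ⊆ ℝ^d be a non-degenerate parallelepiped and let c : Λ'_E → ℂ satisfy: for every r > 0 there exists C_r > 0 with |c(α)| ≤ C_r e^{r|α|²} for all α ∈ Λ'_E. Then for every t > 0 there exist constants C', r' > 0 with |c(α)| e^{-t|α|²} ≤ C' e^{-r'|α|²} for all α ∈ Λ'_E; consequently, for each t > 0 the series f(t,x) = Σ_{α∈Λ'_E} c(α) e^{-t|α|²} e^{i⟨x,α⟩} converges absolutely and uniformly in x, f(t,·) is a smooth E-periodic function, there exist constants C, h > 0 (depending on t) with ‖∂_x^β f(t,·)‖_{L^∞} ≤ C h^{|β|} (β!)^{1/2} for every multi-index β, and f is smooth on (0,∞) × ℝ^d and satisfies the heat equation ∂_t f = Δ_x f there. -/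
open MeasureTheory Filter
open scoped BigOperators InnerProductSpace Topology

noncomputable section

/-- The formal solution `f(t,x) = Σ_{α ∈ Λ'_E} c(α) e^{-t|α|²} e^{i⟨x,α⟩}` of the periodic
heat equation. -/
def heatSum {d : ℕ} (e' : Fin d → Euc d) (c : (Fin d → ℤ) → ℂ) (t : ℝ) (x : Euc d) : ℂ :=
  ∑' ι : Fin d → ℤ,
    c ι * ((Real.exp (-t * ‖latPt e' ι‖ ^ 2) : ℝ) : ℂ) *
      Complex.exp (Complex.I * (⟪x, latPt e' ι⟫_ℝ : ℂ))

/-! ### Summability of Gaussians over a lattice -/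

theorem summable_fintype_prod_of_nonneg {κ ι : Type*} [Fintype κ] [DecidableEq κ] [DecidableEq ι]
    {g : ι → ℝ} (hg0 : ∀ n, 0 ≤ g n) (hg : Summable g) :
    Summable fun x : κ → ι => ∏ k, g (x k) := by
  refine summable_of_sum_le (c := ∏ _k : κ, ∑' n, g n)
    (fun x => Finset.prod_nonneg fun k _ => hg0 _) fun s => ?_
  let t : κ → Finset ι := fun k => s.image fun x => x k
  calc ∑ x ∈ s, ∏ k, g (x k) ≤ ∑ x ∈ Fintype.piFinset t, ∏ k, g (x k) := by
        refine Finset.sum_le_sum_of_subset_of_nonneg (fun x hx => ?_)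
          fun x _ _ => Finset.prod_nonneg fun k _ => hg0 _
        exact Fintype.mem_piFinset.2 fun k => Finset.mem_image_of_mem _ hx
    _ = ∏ k, ∑ n ∈ t k, g n := (Finset.prod_univ_sum t fun _ n => g n).symm
    _ ≤ ∏ _k : κ, ∑' n, g n :=
        Finset.prod_le_prod (fun k _ => Finset.sum_nonneg fun n _ => hg0 n)
          fun k _ => hg.sum_le_tsum _ fun n _ => hg0 n

theorem summable_exp_neg_mul_int_sq {κ : ℝ} (hκ : 0 < κ) :
    Summable fun n : ℤ => Real.exp (-κ * (n : ℝ) ^ 2) := by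
  have h := summable_pow_mul_jacobiTheta₂_term_bound 0 (T := κ / Real.pi) (by positivity) 0
  refine h.congr fun n => ?_
  have := Real.pi_ne_zero
  simp only [pow_zero, one_mul]
  congr 1
  field_simp
  ring

theorem inner_latPt_of_dual {d : ℕ} {e e' : Fin d → Euc d}
    (hdual : ∀ j k, ⟪e j, e' k⟫_ℝ = if j = k then 2 * Real.pi else 0)
    (j : Fin d) (ι : Fin d → ℤ) : ⟪e j, latPt e' ι⟫_ℝ = 2 * Real.pi * ι j := by
  simp [latPt, inner_sum, inner_smul_right, hdual, mul_comm]

theorem summable_exp_neg_mul_latPt_sq {d : ℕ} {e e' : Fin d → Euc d}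
    (hdual : ∀ j k, ⟪e j, e' k⟫_ℝ = if j = k then 2 * Real.pi else 0) {r : ℝ} (hr : 0 < r) :
    Summable fun ι : Fin d → ℤ => Real.exp (-r * ‖latPt e' ι‖ ^ 2) := by
  set K : ℝ := 1 + ∑ j, ‖e j‖ ^ 2 with hK
  have hK0 : 0 < K := by positivity
  have key (ι : Fin d → ℤ) : ∑ j, (ι j : ℝ) ^ 2 ≤ K * ‖latPt e' ι‖ ^ 2 := by
    have h1 (j : Fin d) : (ι j : ℝ) ^ 2 ≤ ‖e j‖ ^ 2 * ‖latPt e' ι‖ ^ 2 := by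
      have h := abs_real_inner_le_norm (e j) (latPt e' ι)
      rw [inner_latPt_of_dual hdual, abs_mul, abs_of_pos Real.two_pi_pos] at h
      have h2 : |(ι j : ℝ)| ≤ ‖e j‖ * ‖latPt e' ι‖ := by
        nlinarith [Real.pi_gt_three, abs_nonneg (ι j : ℝ)]
      rw [← mul_pow, ← sq_abs]
      gcongr
    calc ∑ j, (ι j : ℝ) ^ 2 ≤ ∑ j, ‖e j‖ ^ 2 * ‖latPt e' ι‖ ^ 2 :=
          Finset.sum_le_sum fun j _ => h1 j
      _ = (∑ j, ‖e j‖ ^ 2) * ‖latPt e' ι‖ ^ 2 := (Finset.sum_mul _ _ _).symm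
      _ ≤ K * ‖latPt e' ι‖ ^ 2 := by gcongr; simp [hK]
  refine Summable.of_nonneg_of_le (fun _ => (Real.exp_pos _).le) (fun ι => ?_)
    (summable_fintype_prod_of_nonneg (κ := Fin d) (fun n => (Real.exp_pos _).le)
      (summable_exp_neg_mul_int_sq (κ := r / K) (by positivity)))
  rw [← Real.exp_sum, ← Finset.mul_sum]
  refine Real.exp_le_exp.2 ?_
  have : r / K * ∑ j, (ι j : ℝ) ^ 2 ≤ r * ‖latPt e' ι‖ ^ 2 := by
    calc _ ≤ r / K * (K * ‖latPt e' ι‖ ^ 2) := by gcongr; exact key ι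
      _ = _ := by field_simp
  linarith

/-! ### Vector-valued heat series -/

/-- The coefficients `c` are bounded by `C_r e^{r|a|²}` for every `r > 0`. -/
def SubGaussian {I X V : Type*} [NormedAddCommGroup X] [NormedAddCommGroup V]
    (a : I → X) (c : I → V) : Prop :=
  ∀ r : ℝ, 0 < r → ∃ C : ℝ, 0 < C ∧ ∀ i, ‖c i‖ ≤ C * Real.exp (r * ‖a i‖ ^ 2)

theorem SubGaussian.of_norm_le {I X V W : Type*} [NormedAddCommGroup X] [NormedAddCommGroup V]
    [NormedAddCommGroup W]
    {a : I → X} {c : I → V} {c' : I → W}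
    (hc : SubGaussian a c) {K : ℝ} (hK : 0 < K)
    (h : ∀ i, ‖c' i‖ ≤ K * (1 + ‖a i‖ ^ 2) * ‖c i‖) : SubGaussian a c' := by
  intro r hr
  obtain ⟨C, hC, hb⟩ := hc (r / 2) (by positivity)
  refine ⟨K * (1 + 2 / r) * C, by positivity, fun i => (h i).trans ?_⟩
  have h1 : 1 + ‖a i‖ ^ 2 ≤ (1 + 2 / r) * Real.exp (r / 2 * ‖a i‖ ^ 2) := by
    have h2 := Real.add_one_le_exp (r / 2 * ‖a i‖ ^ 2)
    have h3 : 0 ≤ r / 2 * ‖a i‖ ^ 2 := by positivity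
    calc 1 + ‖a i‖ ^ 2 = 1 + 2 / r * (r / 2 * ‖a i‖ ^ 2) := by field_simp
      _ ≤ Real.exp (r / 2 * ‖a i‖ ^ 2) + 2 / r * Real.exp (r / 2 * ‖a i‖ ^ 2) := by
        gcongr <;> linarith
      _ = _ := by ring
  calc K * (1 + ‖a i‖ ^ 2) * ‖c i‖
      ≤ K * ((1 + 2 / r) * Real.exp (r / 2 * ‖a i‖ ^ 2)) *
          (C * Real.exp (r / 2 * ‖a i‖ ^ 2)) := by
        gcongr
        exact hb i
    _ = K * (1 + 2 / r) * C * (Real.exp (r / 2 * ‖a i‖ ^ 2) * Real.exp (r / 2 * ‖a i‖ ^ 2)) := by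
        ring
    _ = _ := by rw [← Real.exp_add]; congr 2; ring

theorem SubGaussian.exists_gaussian_bound {I X V : Type*} [NormedAddCommGroup X] [NormedAddCommGroup V]
    {a : I → X} {c : I → V}
    (hc : SubGaussian a c) {t : ℝ} (ht : 0 < t) :
    ∃ C : ℝ, 0 < C ∧ ∀ i,
      ‖c i‖ * Real.exp (-t * ‖a i‖ ^ 2) ≤ C * Real.exp (-(t / 2) * ‖a i‖ ^ 2) := by
  obtain ⟨C, hC, hb⟩ := hc (t / 2) (by positivity)
  refine ⟨C, hC, fun i => ?_⟩
  calc _ ≤ C * Real.exp (t / 2 * ‖a i‖ ^ 2) * Real.exp (-t * ‖a i‖ ^ 2) := by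
        gcongr
        exact hb i
    _ = _ := by rw [mul_assoc, ← Real.exp_add]; congr 2; ring

theorem SubGaussian.summable {I X V : Type*} [NormedAddCommGroup X] [NormedAddCommGroup V]
    {a : I → X} {c : I → V}
    (hc : SubGaussian a c) (ha : ∀ r : ℝ, 0 < r → Summable fun i => Real.exp (-r * ‖a i‖ ^ 2))
    {t : ℝ} (ht : 0 < t) : Summable fun i => ‖c i‖ * Real.exp (-t * ‖a i‖ ^ 2) := by
  obtain ⟨C, -, hb⟩ := hc.exists_gaussian_bound ht
  exact Summable.of_nonneg_of_le (fun i => by positivity) hb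
    ((ha (t / 2) (by positivity)).mul_left C)

/-- The real-linear map `(t, x) ↦ -t|α|² + i⟨x, α⟩`. -/
def heatPhase {X : Type*} [NormedAddCommGroup X] [InnerProductSpace ℝ X] (α : X) :
    ℝ × X →L[ℝ] ℂ :=
  (ContinuousLinearMap.fst ℝ ℝ X).smulRight (-(‖α‖ ^ 2 : ℝ) : ℂ) +
    ((innerSL ℝ α).comp (ContinuousLinearMap.snd ℝ ℝ X)).smulRight Complex.I

/-- The series `∑ e^{-t|a i|²} e^{i⟨x, a i⟩} c i` with vector coefficients. -/
def heatSeries {I X V : Type*} [NormedAddCommGroup X] [InnerProductSpace ℝ X]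
    [NormedAddCommGroup V] [NormedSpace ℂ V] (a : I → X) (c : I → V) (p : ℝ × X) : V :=
  ∑' i, Complex.exp (heatPhase (a i) p) • c i

section HeatSeries

variable {I X V : Type*} [NormedAddCommGroup X] [InnerProductSpace ℝ X]

theorem heatPhase_apply (α : X) (p : ℝ × X) :
    heatPhase α p = -(p.1 : ℂ) * (‖α‖ ^ 2 : ℝ) + Complex.I * (⟪p.2, α⟫_ℝ : ℂ) := by
  simp [heatPhase, real_inner_comm, mul_comm]

theorem norm_exp_heatPhase (α : X) (p : ℝ × X) :
    ‖Complex.exp (heatPhase α p)‖ = Real.exp (-p.1 * ‖α‖ ^ 2) := by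
  rw [Complex.norm_exp, heatPhase_apply]
  congr 1
  have : ((-(p.1 : ℂ) * (‖α‖ ^ 2 : ℝ)) + Complex.I * (⟪p.2, α⟫_ℝ : ℂ)) =
      ((-p.1 * ‖α‖ ^ 2 : ℝ) : ℂ) + (⟪p.2, α⟫_ℝ : ℂ) * Complex.I := by push_cast; ring
  rw [this, Complex.add_re, Complex.ofReal_re, Complex.re_ofReal_mul]
  simp

theorem norm_heatPhase_le (α : X) : ‖heatPhase α‖ ≤ 2 * (1 + ‖α‖ ^ 2) := by
  refine ContinuousLinearMap.opNorm_le_bound _ (by positivity) fun p => ?_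
  rw [heatPhase_apply]
  have h1 : ‖-(p.1 : ℂ) * (‖α‖ ^ 2 : ℝ)‖ ≤ ‖p‖ * ‖α‖ ^ 2 := by
    rw [norm_mul, norm_neg, Complex.norm_real, Complex.norm_real]
    simp only [norm_pow, norm_norm]
    gcongr
    exact norm_fst_le p
  have h2 : ‖Complex.I * (⟪p.2, α⟫_ℝ : ℂ)‖ ≤ ‖p‖ * ‖α‖ := by
    rw [norm_mul, Complex.norm_I, one_mul, Complex.norm_real]
    exact (norm_inner_le_norm _ _).trans (by gcongr; exact norm_snd_le p)
  refine (norm_add_le _ _).trans ?_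
  nlinarith [norm_nonneg p, norm_nonneg α, sq_nonneg (‖α‖ - 1),
    mul_nonneg (norm_nonneg p) (sq_nonneg (‖α‖ - 1))]

variable [NormedAddCommGroup V] [NormedSpace ℂ V]

theorem norm_heatSeries_term (α : X) (v : V) (p : ℝ × X) :
    ‖Complex.exp (heatPhase α p) • v‖ = ‖v‖ * Real.exp (-p.1 * ‖α‖ ^ 2) := by
  rw [norm_smul, norm_exp_heatPhase, mul_comm]

theorem SubGaussian.smulRight {a : I → X} {c : I → V} (hc : SubGaussian a c) :
    SubGaussian a fun i => (heatPhase (a i)).smulRight (c i) := by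
  refine hc.of_norm_le (K := 2) two_pos fun i => ?_
  refine ContinuousLinearMap.opNorm_le_bound _ (by positivity) fun q => ?_
  rw [ContinuousLinearMap.smulRight_apply, norm_smul]
  calc ‖heatPhase (a i) q‖ * ‖c i‖ ≤ 2 * (1 + ‖a i‖ ^ 2) * ‖q‖ * ‖c i‖ := by
        gcongr
        exact (heatPhase (a i)).le_of_opNorm_le (norm_heatPhase_le _) q
    _ = _ := by ring

theorem summable_heatSeries_term [CompleteSpace V] {a : I → X} {c : I → V} (hc : SubGaussian a c)
    (ha : ∀ r : ℝ, 0 < r → Summable fun i => Real.exp (-r * ‖a i‖ ^ 2))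
    {p : ℝ × X} (hp : 0 < p.1) : Summable fun i => Complex.exp (heatPhase (a i) p) • c i :=
  .of_norm ((hc.summable ha hp).congr fun _ => (norm_heatSeries_term _ _ _).symm)

theorem hasFDerivAt_heatSeries [CompleteSpace V] {a : I → X} {c : I → V} (hc : SubGaussian a c)
    (ha : ∀ r : ℝ, 0 < r → Summable fun i => Real.exp (-r * ‖a i‖ ^ 2))
    {p : ℝ × X} (hp : 0 < p.1) :
    HasFDerivAt (heatSeries a c) (heatSeries a (fun i => (heatPhase (a i)).smulRight (c i)) p)
      p := by
  have hp2 : p.1 / 2 < p.1 := by linarith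
  refine hasFDerivAt_tsum_of_isPreconnected (𝕜 := ℝ)
    (f := fun i q => Complex.exp (heatPhase (a i) q) • c i)
    (f' := fun i q => Complex.exp (heatPhase (a i) q) • (heatPhase (a i)).smulRight (c i))
    (s := Set.Ioi (p.1 / 2) ×ˢ Set.univ) (x₀ := p)
    (hc.smulRight.summable ha (half_pos hp)) (isOpen_Ioi.prod isOpen_univ)
    ((convex_Ioi _).prod convex_univ).isPreconnected (fun i q _ => ?_) (fun i q hq => ?_)
    ⟨hp2, trivial⟩ (summable_heatSeries_term hc ha hp) ⟨hp2, trivial⟩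
  · convert ((heatPhase (a i)).hasFDerivAt (x := q)).cexp.smul_const (c i) using 1
    ext v <;> simp [mul_smul]
  · rw [norm_smul, norm_exp_heatPhase, mul_comm]
    have : p.1 / 2 ≤ q.1 := hq.1.le
    gcongr

theorem heatSeries_smulRight_apply [CompleteSpace V] {a : I → X} {c : I → V}
    (hc : SubGaussian a c) (ha : ∀ r : ℝ, 0 < r → Summable fun i => Real.exp (-r * ‖a i‖ ^ 2))
    {p : ℝ × X} (hp : 0 < p.1) (v : ℝ × X) :
    heatSeries a (fun i => (heatPhase (a i)).smulRight (c i)) p v =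
      heatSeries a (fun i => heatPhase (a i) v • c i) p := by
  exact (ContinuousLinearMap.apply ℝ V v).map_tsum (summable_heatSeries_term hc.smulRight ha hp)

theorem SubGaussian.heatPhase_smul {a : I → X} {c : I → V} (hc : SubGaussian a c) (v : ℝ × X) :
    SubGaussian a fun i => heatPhase (a i) v • c i := by
  refine hc.of_norm_le (K := 2 * (1 + ‖v‖)) (by positivity) fun i => ?_
  rw [norm_smul]
  calc ‖heatPhase (a i) v‖ * ‖c i‖ ≤ 2 * (1 + ‖a i‖ ^ 2) * (1 + ‖v‖) * ‖c i‖ := by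
        gcongr
        exact ((heatPhase (a i)).le_of_opNorm_le (norm_heatPhase_le _) v).trans
          (by gcongr; linarith)
    _ = _ := by ring

theorem norm_heatSeries_le [CompleteSpace V] {a : I → X} {c : I → V} (hc : SubGaussian a c)
    (ha : ∀ r : ℝ, 0 < r → Summable fun i => Real.exp (-r * ‖a i‖ ^ 2))
    {p : ℝ × X} (hp : 0 < p.1) :
    ‖heatSeries a c p‖ ≤ ∑' i, ‖c i‖ * Real.exp (-p.1 * ‖a i‖ ^ 2) :=
  tsum_of_norm_bounded (hc.summable ha hp).hasSum fun _ => (norm_heatSeries_term _ _ _).le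

end HeatSeries

theorem contDiffOn_heatSeries.{u, v} {I : Type v} {X : Type u} [NormedAddCommGroup X]
    [InnerProductSpace ℝ X] {a : I → X}
    (ha : ∀ r : ℝ, 0 < r → Summable fun i => Real.exp (-r * ‖a i‖ ^ 2)) (n : ℕ) :
    ∀ {V : Type u} [NormedAddCommGroup V] [NormedSpace ℂ V] [CompleteSpace V] {c : I → V},
      SubGaussian a c → ContDiffOn ℝ n (heatSeries a c) (Set.Ioi 0 ×ˢ Set.univ) := by
  induction n with
  | zero =>
    intro V _ _ _ c hc
    refine contDiffOn_zero.2 fun p hp => ?_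
    exact (hasFDerivAt_heatSeries hc ha hp.1).continuousAt.continuousWithinAt
  | succ n ih =>
    intro V _ _ _ c hc
    push_cast
    rw [contDiffOn_succ_iff_hasFDerivWithinAt_of_uniqueDiffOn
      (isOpen_Ioi.prod isOpen_univ).uniqueDiffOn]
    refine ⟨by simp, _, ih hc.smulRight, fun p hp => ?_⟩
    exact (hasFDerivAt_heatSeries hc ha hp.1).hasFDerivWithinAt

/-! ### Iterated partial derivatives of the heat series -/

theorem heatPhase_single {d : ℕ} (α : Euc d) (j : Fin d) :
    heatPhase α (0, EuclideanSpace.single j 1) = Complex.I * (α j : ℂ) := by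
  simp [heatPhase_apply, EuclideanSpace.inner_single_left]

theorem fderiv_heatSeries_single {d : ℕ} {I : Type*} {a : I → Euc d} {c : I → ℂ}
    (hc : SubGaussian a c) (ha : ∀ r : ℝ, 0 < r → Summable fun i => Real.exp (-r * ‖a i‖ ^ 2))
    {t : ℝ} (ht : 0 < t) (x : Euc d) (j : Fin d) :
    fderiv ℝ (fun y => heatSeries a c (t, y)) x (EuclideanSpace.single j 1) =
      heatSeries a (fun i => Complex.I * (a i j : ℂ) * c i) (t, x) := by
  have h := (hasFDerivAt_heatSeries hc ha (p := (t, x)) ht).comp x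
    (hasFDerivAt_prodMk_right t x)
  have h' := h.fderiv
  simp only [Function.comp_def] at h'
  rw [h']
  refine (heatSeries_smulRight_apply hc ha (p := (t, x)) ht
    (0, EuclideanSpace.single j 1)).trans ?_
  simp only [heatPhase_single, smul_eq_mul]

theorem pdSeq_heatSeries {d : ℕ} {I : Type*} {a : I → Euc d}
    (ha : ∀ r : ℝ, 0 < r → Summable fun i => Real.exp (-r * ‖a i‖ ^ 2)) {t : ℝ} (ht : 0 < t)
    (L : List (Fin d)) {c : I → ℂ} (hc : SubGaussian a c) :
    SubGaussian a (fun i => (L.map fun j => Complex.I * (a i j : ℂ)).prod * c i) ∧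
    pdSeq L (fun x => heatSeries a c (t, x)) = fun x =>
      heatSeries a (fun i => (L.map fun j => Complex.I * (a i j : ℂ)).prod * c i) (t, x) := by
  induction L generalizing c with
  | nil => simpa [pdSeq] using hc
  | cons j L ih =>
    have hc' : SubGaussian a fun i => Complex.I * (a i j : ℂ) * c i := by
      simpa only [heatPhase_single, smul_eq_mul] using
        hc.heatPhase_smul (0, EuclideanSpace.single j 1)
    have e : (fun i => ((j :: L).map fun j => Complex.I * (a i j : ℂ)).prod * c i) =
        fun i => (L.map fun j => Complex.I * (a i j : ℂ)).prod *
          (Complex.I * (a i j : ℂ) * c i) := by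
      funext i
      simp only [List.map_cons, List.prod_cons]
      ring
    rw [e, pdSeq]
    simpa only [fderiv_heatSeries_single hc ha ht] using ih hc'

theorem prod_map_mIdxL {d : ℕ} {M : Type*} [CommMonoid M] (β : Fin d → ℕ) (f : Fin d → M) :
    ((mIdxL β).map f).prod = ∏ j, f j ^ β j := by
  rw [mIdxL, List.map_flatMap, List.flatMap, List.prod_flatten, Fin.prod_univ_def]
  simp [Function.comp_def]

theorem pD_heatSeries {d : ℕ} {I : Type*} {a : I → Euc d} {c : I → ℂ}
    (hc : SubGaussian a c) (ha : ∀ r : ℝ, 0 < r → Summable fun i => Real.exp (-r * ‖a i‖ ^ 2))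
    {t : ℝ} (ht : 0 < t) (β : Fin d → ℕ) (x : Euc d) :
    pD β (fun x => heatSeries a c (t, x)) x =
      heatSeries a (fun i => (∏ j, (Complex.I * (a i j : ℂ)) ^ β j) * c i) (t, x) := by
  rw [pD, (pdSeq_heatSeries ha ht _ hc).2]
  simp only [prod_map_mIdxL]

theorem SubGaussian.prod_pow_mul {d : ℕ} {I : Type*} {a : I → Euc d} {c : I → ℂ}
    (hc : SubGaussian a c) (ha : ∀ r : ℝ, 0 < r → Summable fun i => Real.exp (-r * ‖a i‖ ^ 2))
    (β : Fin d → ℕ) :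
    SubGaussian a fun i => (∏ j, (Complex.I * (a i j : ℂ)) ^ β j) * c i := by
  simpa only [prod_map_mIdxL] using (pdSeq_heatSeries ha one_pos (mIdxL β) hc).1

/-! ### Gevrey bounds -/

theorem abs_pow_le_sqrt_factorial_mul_exp {s : ℝ} (hs : 0 < s) (x : ℝ) (n : ℕ) :
    |x| ^ n ≤ (√s)⁻¹ ^ n * √(n.factorial) * Real.exp (s / 2 * x ^ 2) := by
  have hs' := Real.sqrt_pos.2 hs
  rw [← pow_le_pow_iff_left₀ (by positivity) (by positivity) two_ne_zero]
  have h := Real.pow_div_factorial_le_exp (s * x ^ 2) (by positivity) n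
  rw [div_le_iff₀ (by positivity)] at h
  have e1 : (|x| ^ n) ^ 2 = (s⁻¹) ^ n * (s * x ^ 2) ^ n := by
    rw [← mul_pow, inv_mul_cancel_left₀ hs.ne', ← pow_mul, mul_comm n, pow_mul, sq_abs]
  have e2 : ((√s)⁻¹ ^ n * √(n.factorial) * Real.exp (s / 2 * x ^ 2)) ^ 2 =
      (s⁻¹) ^ n * (Real.exp (s * x ^ 2) * n.factorial) := by
    rw [mul_pow, mul_pow, Real.sq_sqrt (by positivity), ← Real.exp_nat_mul, ← pow_mul,
      mul_comm n 2, pow_mul, inv_pow, Real.sq_sqrt hs.le]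
    push_cast
    rw [show 2 * (s / 2 * x ^ 2) = s * x ^ 2 by ring]
    ring
  rw [e1, e2]
  gcongr

theorem prod_abs_pow_le_sqrt_factorial_mul_exp {d : ℕ} {s : ℝ} (hs : 0 < s) (α : Euc d)
    (β : Fin d → ℕ) :
    ∏ j, |α j| ^ β j ≤ (√s)⁻¹ ^ (∑ j, β j) * ((∏ j, (β j).factorial : ℕ) : ℝ) ^ ((1 : ℝ) / 2) *
      Real.exp (s / 2 * ‖α‖ ^ 2) := by
  refine (Finset.prod_le_prod (fun j _ => by positivity)
    fun j _ => abs_pow_le_sqrt_factorial_mul_exp hs (α j) (β j)).trans_eq ?_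
  rw [Finset.prod_mul_distrib, Finset.prod_mul_distrib, Finset.prod_pow_eq_pow_sum,
    ← Real.exp_sum, ← Finset.mul_sum, EuclideanSpace.real_norm_sq_eq, ← Real.sqrt_eq_rpow,
    Nat.cast_prod, Real.sqrt_prod]
  exact fun _ _ => by positivity

theorem exists_gevrey_bound_heatSeries {d : ℕ} {I : Type*} {a : I → Euc d} {c : I → ℂ}
    (hc : SubGaussian a c) (ha : ∀ r : ℝ, 0 < r → Summable fun i => Real.exp (-r * ‖a i‖ ^ 2))
    {t : ℝ} (ht : 0 < t) : ∃ C h : ℝ, 0 < C ∧ 0 < h ∧ ∀ (β : Fin d → ℕ) (x : Euc d),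
      ‖pD β (fun x => heatSeries a c (t, x)) x‖ ≤
        C * h ^ (∑ i, β i) * ((∏ i, (β i).factorial : ℕ) : ℝ) ^ ((1 : ℝ) / 2) := by
  obtain ⟨C, hC, hb⟩ := hc.exists_gaussian_bound ht
  have hsum := ha (t / 4) (by positivity)
  refine ⟨C * (1 + ∑' i, Real.exp (-(t / 4) * ‖a i‖ ^ 2)), (√(t / 2))⁻¹, by positivity,
    by positivity, fun β x => ?_⟩
  rw [pD_heatSeries hc ha ht]
  set B : ℝ := (√(t / 2))⁻¹ ^ (∑ j, β j) * ((∏ j, (β j).factorial : ℕ) : ℝ) ^ ((1 : ℝ) / 2)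
  have hB : 0 ≤ B := by positivity
  have hterm (i : I) : ‖(∏ j, (Complex.I * (a i j : ℂ)) ^ β j) * c i‖ *
      Real.exp (-t * ‖a i‖ ^ 2) ≤ C * B * Real.exp (-(t / 4) * ‖a i‖ ^ 2) := by
    have e : ‖(∏ j, (Complex.I * (a i j : ℂ)) ^ β j) * c i‖ = (∏ j, |a i j| ^ β j) * ‖c i‖ := by
      simp [norm_prod]
    rw [e, mul_assoc]
    calc (∏ j, |a i j| ^ β j) * (‖c i‖ * Real.exp (-t * ‖a i‖ ^ 2))
        ≤ B * Real.exp (t / 2 / 2 * ‖a i‖ ^ 2) * (C * Real.exp (-(t / 2) * ‖a i‖ ^ 2)) := by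
          exact mul_le_mul (prod_abs_pow_le_sqrt_factorial_mul_exp (half_pos ht) (a i) β) (hb i)
            (by positivity) (by positivity)
      _ = C * B * (Real.exp (t / 2 / 2 * ‖a i‖ ^ 2) * Real.exp (-(t / 2) * ‖a i‖ ^ 2)) := by ring
      _ = _ := by rw [← Real.exp_add]; congr 2; ring
  have hc' := hc.prod_pow_mul ha β
  calc _ ≤ _ := norm_heatSeries_le hc' ha (p := (t, x)) ht
    _ ≤ ∑' i, C * B * Real.exp (-(t / 4) * ‖a i‖ ^ 2) :=
        (hc'.summable ha ht).tsum_le_tsum hterm (hsum.mul_left _)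
    _ = C * B * ∑' i, Real.exp (-(t / 4) * ‖a i‖ ^ 2) := tsum_mul_left
    _ ≤ C * B * (1 + ∑' i, Real.exp (-(t / 4) * ‖a i‖ ^ 2)) := by gcongr; linarith
    _ = _ := by simp only [B]; ring

/-! ### The heat equation -/

theorem deriv_heatSeries_eq_laplacian {d : ℕ} {I : Type*} {a : I → Euc d} {c : I → ℂ}
    (hc : SubGaussian a c) (ha : ∀ r : ℝ, 0 < r → Summable fun i => Real.exp (-r * ‖a i‖ ^ 2))
    {t : ℝ} (ht : 0 < t) (x : Euc d) :
    deriv (fun τ : ℝ => heatSeries a c (τ, x)) t =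
      ∑ j : Fin d, pD (Pi.single j 2) (fun x => heatSeries a c (t, x)) x := by
  have h := (hasFDerivAt_heatSeries hc ha (p := (t, x)) ht).comp_hasDerivAt t
    ((hasDerivAt_id t).prodMk (hasDerivAt_const t x))
  rw [show (fun τ : ℝ => heatSeries a c (τ, x)) =
    heatSeries a c ∘ fun τ => (id τ, x) from rfl, h.deriv]
  refine (heatSeries_smulRight_apply hc ha (p := (t, x)) ht (1, 0)).trans ?_
  simp only [pD_heatSeries hc ha ht]
  simp only [heatSeries]
  rw [← Summable.tsum_finsetSum fun j _ =>
    summable_heatSeries_term (hc.prod_pow_mul ha _) ha (p := (t, x)) ht]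
  refine tsum_congr fun i => ?_
  have e (j : Fin d) : ∏ k, (Complex.I * (a i k : ℂ)) ^ (Pi.single j 2 : Fin d → ℕ) k =
      -(a i j : ℂ) ^ 2 := by
    rw [Finset.prod_eq_single j (fun k _ hk => by simp [hk]) (by simp)]
    simp [mul_pow]
  simp only [e, ← Finset.smul_sum, ← Finset.sum_mul, Finset.sum_neg_distrib]
  have h1 : heatPhase (a i) (1, 0) = -∑ j, (a i j : ℂ) ^ 2 := by
    rw [heatPhase_apply, EuclideanSpace.real_norm_sq_eq]
    simp
  rw [h1, smul_eq_mul (_ : ℂ) (c i)]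

theorem heatSum_eq_heatSeries {d : ℕ} (e' : Fin d → Euc d) (c : (Fin d → ℤ) → ℂ) (t : ℝ)
    (x : Euc d) : heatSum e' c t x = heatSeries (latPt e') c (t, x) := by
  refine tsum_congr fun ι => ?_
  rw [heatPhase_apply, Complex.exp_add, smul_eq_mul]
  push_cast
  ring

theorem exp_inner_add_latPt {d : ℕ} {e e' : Fin d → Euc d}
    (hdual : ∀ j k, ⟪e j, e' k⟫_ℝ = if j = k then 2 * Real.pi else 0)
    (x : Euc d) (j ι : Fin d → ℤ) :
    Complex.exp (Complex.I * (⟪x + latPt e j, latPt e' ι⟫_ℝ : ℂ)) =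
      Complex.exp (Complex.I * (⟪x, latPt e' ι⟫_ℝ : ℂ)) := by
  have h : ⟪latPt e j, latPt e' ι⟫_ℝ = ((∑ k, j k * ι k : ℤ) : ℝ) * (2 * Real.pi) := by
    rw [latPt, sum_inner]
    simp only [real_inner_smul_left, inner_latPt_of_dual hdual]
    push_cast
    rw [Finset.sum_mul]
    exact Finset.sum_congr rfl fun k _ => by ring
  rw [inner_add_left, h, Complex.exp_eq_exp_iff_exists_int]
  refine ⟨∑ k, j k * ι k, ?_⟩
  push_cast
  ring

/-- well-posedness of the periodic heat equation: if the coefficients satisfy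
`|c(α)| ≤ C_r e^{r|α|²}` for every `r > 0`, then for each `t > 0` the damped coefficients have
Gaussian decay, the series converges absolutely and uniformly to a smooth `E`-periodic
Gevrey-`1/2` function, `f` is smooth on `(0,∞) × ℝ^d` and solves `∂_t f = Δ_x f` there. -/
theorem periodic_heat_equation_wellposed
    {d : ℕ} (hd : 1 ≤ d)
    (e e' : Fin d → Euc d) (he : LinearIndependent ℝ e)
    (hdual : ∀ j k, ⟪e j, e' k⟫_ℝ = if j = k then 2 * Real.pi else 0)
    (c : (Fin d → ℤ) → ℂ)
    (hc : ∀ r : ℝ, 0 < r → ∃ C : ℝ, 0 < C ∧ ∀ ι : Fin d → ℤ,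
      ‖c ι‖ ≤ C * Real.exp (r * ‖latPt e' ι‖ ^ 2)) :
    (∀ t : ℝ, 0 < t → ∃ C' r' : ℝ, 0 < C' ∧ 0 < r' ∧ ∀ ι : Fin d → ℤ,
        ‖c ι‖ * Real.exp (-t * ‖latPt e' ι‖ ^ 2) ≤ C' * Real.exp (-r' * ‖latPt e' ι‖ ^ 2)) ∧
    (∀ t : ℝ, 0 < t → Summable fun ι : Fin d → ℤ =>
        ‖c ι * ((Real.exp (-t * ‖latPt e' ι‖ ^ 2) : ℝ) : ℂ)‖) ∧
    (∀ t : ℝ, 0 < t →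
      TendstoUniformly
        (fun (F : Finset (Fin d → ℤ)) (x : Euc d) =>
          ∑ ι ∈ F, c ι * ((Real.exp (-t * ‖latPt e' ι‖ ^ 2) : ℝ) : ℂ) *
            Complex.exp (Complex.I * (⟪x, latPt e' ι⟫_ℝ : ℂ)))
        (heatSum e' c t) atTop) ∧
    (∀ t : ℝ, 0 < t → ContDiff ℝ (⊤ : ℕ∞) (heatSum e' c t)) ∧
    (∀ t : ℝ, 0 < t → ∀ (x : Euc d) (j : Fin d → ℤ),
        heatSum e' c t (x + latPt e j) = heatSum e' c t x) ∧
    (∀ t : ℝ, 0 < t → ∃ C h : ℝ, 0 < C ∧ 0 < h ∧ ∀ (β : Fin d → ℕ) (x : Euc d),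
        ‖pD β (heatSum e' c t) x‖ ≤
          C * h ^ (∑ i, β i) * (((∏ i, (β i).factorial : ℕ) : ℝ)) ^ ((1:ℝ)/2)) ∧
    ContDiffOn ℝ (⊤ : ℕ∞) (fun p : ℝ × Euc d => heatSum e' c p.1 p.2)
      (Set.Ioi (0:ℝ) ×ˢ (Set.univ : Set (Euc d))) ∧
    (∀ t : ℝ, 0 < t → ∀ x : Euc d,
        deriv (fun τ : ℝ => heatSum e' c τ x) t =
          ∑ i : Fin d, pD (Pi.single i 2) (heatSum e' c t) x) := by
  have ha : ∀ r : ℝ, 0 < r → Summable fun ι => Real.exp (-r * ‖latPt e' ι‖ ^ 2) :=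
    fun r hr => summable_exp_neg_mul_latPt_sq hdual hr
  have hc : SubGaussian (latPt e') c := hc
  have hsum (t : ℝ) : heatSum e' c t = fun x => heatSeries (latPt e') c (t, x) :=
    funext fun x => heatSum_eq_heatSeries e' c t x
  have hsmooth : ContDiffOn ℝ (⊤ : ℕ∞) (heatSeries (latPt e') c)
      (Set.Ioi (0 : ℝ) ×ˢ (Set.univ : Set (Euc d))) :=
    contDiffOn_infty.2 fun n => contDiffOn_heatSeries ha n hc
  have hnorm (t : ℝ) (ι : Fin d → ℤ) :
      ‖c ι * ((Real.exp (-t * ‖latPt e' ι‖ ^ 2) : ℝ) : ℂ)‖ =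
        ‖c ι‖ * Real.exp (-t * ‖latPt e' ι‖ ^ 2) := by
    rw [norm_mul, Complex.norm_real, Real.norm_of_nonneg (Real.exp_pos _).le]
  refine ⟨fun t ht => ?_, fun t ht => ?_, fun t ht => ?_, fun t ht => ?_, fun t _ x j => ?_,
    fun t ht => ?_, ?_, fun t ht x => ?_⟩
  · obtain ⟨C, hC, hb⟩ := hc.exists_gaussian_bound ht
    exact ⟨C, t / 2, hC, half_pos ht, hb⟩
  · exact (hc.summable ha ht).congr fun ι => (hnorm t ι).symm
  · refine tendstoUniformly_tsum (hc.summable ha ht) fun ι x => ?_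
    rw [norm_mul, hnorm, mul_comm Complex.I, Complex.norm_exp_ofReal_mul_I, mul_one]
  · rw [hsum, ← contDiffOn_univ]
    exact hsmooth.comp (contDiff_prodMk_right t).contDiffOn fun x _ => ⟨ht, trivial⟩
  · simp only [heatSum, exp_inner_add_latPt hdual]
  · simpa only [hsum] using exists_gevrey_bound_heatSeries hc ha ht
  · simpa only [hsum] using hsmooth
  · simpa only [hsum] using deriv_heatSeries_eq_laplacian hc ha ht x

end
end
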